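/- arXiv:1406.4904 — 3 statements merged into one kernel-verified Lean document; each statement's English description precedes it below -/
import Mathlib

section
/- Suppose u satisfies Condition 2.1 with constant K and ε_m = m/(n+m) < 1 − p/K. Then there exists a constant C < ∞, depending only on X, u and m, such that for every list Y = (y_1,…,y_m) of contaminating points and every M-estimate of scatter V for Z = X ∪ Y about t, trace(V⁻¹) ≤ C. -/
open Matrix Finset Filter

noncomputable section

/-- Condition 2.1 with constant `K`: `u` is nonnegative, non-increasing and continuous on
`(0,∞)`; `ψ(s) = s·u(s)` is non-decreasing, strictly increasing wherever `ψ(s) < K`,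
and `K = sup_{s>0} ψ(s)` (in particular `ψ` is bounded); and `K > p`. -/
structure Cond21 (p : ℕ) (u : ℝ → ℝ) (K : ℝ) : Prop where
  nonneg : ∀ ⦃s : ℝ⦄, 0 < s → 0 ≤ u s
  antitone : ∀ ⦃s₁ s₂ : ℝ⦄, 0 < s₁ → s₁ ≤ s₂ → u s₂ ≤ u s₁
  cont : ContinuousOn u (Set.Ioi 0)
  psi_mono : ∀ ⦃s₁ s₂ : ℝ⦄, 0 < s₁ → s₁ ≤ s₂ → s₁ * u s₁ ≤ s₂ * u s₂
  psi_strictMono : ∀ ⦃s₁ s₂ : ℝ⦄, 0 < s₁ → s₁ < s₂ → s₁ * u s₁ < K → s₁ * u s₁ < s₂ * u s₂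
  psi_lub : IsLUB {y : ℝ | ∃ s : ℝ, 0 < s ∧ y = s * u s} K
  K_gt_p : (p : ℝ) < K

/-- `V` is an M-estimate of scatter for the list `z` about the center `t`:
`V` is positive definite (hence symmetric) and satisfies
`V = (1/N) Σᵢ u(sᵢ) (zᵢ - t)(zᵢ - t)ᵀ` with `sᵢ = (zᵢ - t)ᵀ V⁻¹ (zᵢ - t)`,
the `i`-th summand being the zero matrix when `zᵢ = t`. -/
def IsScatterMEstimate {p N : ℕ} (u : ℝ → ℝ) (t : Fin p → ℝ)
    (z : Fin N → Fin p → ℝ) (V : Matrix (Fin p) (Fin p) ℝ) : Prop :=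
  V.PosDef ∧
    V = (N : ℝ)⁻¹ • ∑ i : Fin N,
      if z i = t then (0 : Matrix (Fin p) (Fin p) ℝ)
      else u ((z i - t) ⬝ᵥ (V⁻¹ *ᵥ (z i - t))) • Matrix.vecMulVec (z i - t) (z i - t)

/-- A list of points of `ℝᵖ` is in general position about `t` if any `p` of the
differences (point − t), taken with distinct indices, are linearly independent. -/
def GenPosAbout {p n : ℕ} (t : Fin p → ℝ) (x : Fin n → Fin p → ℝ) : Prop :=
  ∀ f : Fin p → Fin n, Function.Injective f →
    LinearIndependent ℝ (fun j : Fin p => x (f j) - t)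

/-- Squared Euclidean distance from `t` to `z`. -/
def sqDist {p : ℕ} (t z : Fin p → ℝ) : ℝ := (z - t) ⬝ᵥ (z - t)

/-- The unit direction `θ(z) = (z - t)/‖z - t‖` (Euclidean norm). -/
def dirFrom {p : ℕ} (t z : Fin p → ℝ) : Fin p → ℝ :=
  (Real.sqrt (sqDist t z))⁻¹ • (z - t)

/-- `Y ∈ C_{1,ρ,m}(X)`: for every choice of `p` points of `Z = X ∪ Y` with distinct
indices, all different from `t`, the smallest eigenvalue of `Σⱼ θ(z_{i(j)})θ(z_{i(j)})ᵀ`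
exceeds `ρ`; this is expressed via the Rayleigh quotient characterization of the
smallest eigenvalue of a symmetric matrix. -/
def InC1 {p n m : ℕ} (ρ : ℝ) (t : Fin p → ℝ) (X : Fin n → Fin p → ℝ)
    (Y : Fin m → Fin p → ℝ) : Prop :=
  ∀ f : Fin p → Fin (n + m), Function.Injective f →
    (∀ j, Fin.append X Y (f j) ≠ t) →
    ∀ v : Fin p → ℝ, v ⬝ᵥ v = 1 →
      ρ < v ⬝ᵥ ((∑ j : Fin p,
        Matrix.vecMulVec (dirFrom t (Fin.append X Y (f j)))
          (dirFrom t (Fin.append X Y (f j)))) *ᵥ v)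

/-- `Y ∈ C_{2,r,m}(X)`: every contaminating point satisfies `‖yᵢ - t‖² > r`. -/
def InC2 {p m : ℕ} (r : ℝ) (t : Fin p → ℝ) (Y : Fin m → Fin p → ℝ) : Prop :=
  ∀ i : Fin m, r < sqDist t (Y i)

/-- `Y ∈ C_{3,B,m}(X)`: every contaminating point satisfies `‖yᵢ - t‖² < B`. -/
def InC3 {p m : ℕ} (B : ℝ) (t : Fin p → ℝ) (Y : Fin m → Fin p → ℝ) : Prop :=
  ∀ i : Fin m, sqDist t (Y i) < B

/-- For `A` positive definite and `Q P = 1`, the matrix `B = A (A + c QᵀQ)⁻¹ A` is positive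
semidefinite, dominates `A - c QᵀQ`, and `tr (B A⁻¹)` falls short of `p` by an amount controlled
by the values of the form `A` on the columns of `P`. -/
theorem exists_posSemidef_truncation {p : ℕ} {A P Q : Matrix (Fin p) (Fin p) ℝ}
    (hA : A.PosDef) (hQP : Q * P = 1) {c : ℝ} (hc : 0 < c) :
    ∃ B : Matrix (Fin p) (Fin p) ℝ, (∀ x, 0 ≤ x ⬝ᵥ (B *ᵥ x)) ∧
      (∀ x, x ⬝ᵥ (A *ᵥ x) - c * ((Q *ᵥ x) ⬝ᵥ (Q *ᵥ x)) ≤ x ⬝ᵥ (B *ᵥ x)) ∧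
      (B * A⁻¹).trace ≤ p - ∑ j, c / (P.col j ⬝ᵥ (A *ᵥ P.col j) + c) := by
  set G : Matrix (Fin p) (Fin p) ℝ := Qᵀ * Q with hG
  set H := A + c • G with hH
  have hGpsd : G.PosSemidef := by
    simpa [hG, conjTranspose_eq_transpose_of_trivial] using posSemidef_conjTranspose_mul_self Q
  have hHpd : H.PosDef := hA.add_posSemidef (hGpsd.smul hc.le)
  have hHinv : (H⁻¹).PosDef := hHpd.inv
  have hHu : IsUnit H.det := (isUnit_iff_isUnit_det _).1 hHpd.isUnit
  have hAu : IsUnit A.det := (isUnit_iff_isUnit_det _).1 hA.isUnit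
  have h1 : H * H⁻¹ = 1 := mul_nonsing_inv _ hHu
  have h2 : H⁻¹ * H = 1 := nonsing_inv_mul _ hHu
  have hAH : A = H - c • G := by simp [hH]
  have hAt : Aᵀ = A := by simpa [conjTranspose_eq_transpose_of_trivial] using hA.isHermitian.eq
  have hGt : Gᵀ = G := by simp [hG]
  have hnn : ∀ y : Fin p → ℝ, 0 ≤ y ⬝ᵥ (H⁻¹ *ᵥ y) := fun y => by
    simpa using hHinv.posSemidef.dotProduct_mulVec_nonneg y
  have conj : ∀ (M : Matrix (Fin p) (Fin p) ℝ), Mᵀ = M → ∀ x : Fin p → ℝ,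
      x ⬝ᵥ ((M * H⁻¹ * M) *ᵥ x) = (M *ᵥ x) ⬝ᵥ (H⁻¹ *ᵥ (M *ᵥ x)) := fun M hM x => by
    rw [← mulVec_mulVec, ← mulVec_mulVec, dotProduct_mulVec, ← mulVec_transpose, hM]
  refine ⟨A * H⁻¹ * A, fun x => ?_, fun x => ?_, ?_⟩
  · rw [conj A hAt]; exact hnn _
  · have hB : A * H⁻¹ * A = A - c • G + (c * c) • (G * H⁻¹ * G) := by
      have : A * H⁻¹ * A = (H * H⁻¹) * H - c • (G * (H⁻¹ * H)) - c • ((H * H⁻¹) * G)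
          + (c * c) • (G * H⁻¹ * G) := by
        conv_lhs => rw [hAH]
        simp only [sub_mul, mul_sub, smul_mul_assoc, mul_smul_comm, Matrix.mul_assoc, smul_smul,
          smul_sub]
        abel
      rw [this, h1, h2, hH]
      simp only [Matrix.one_mul, Matrix.mul_one]
      abel
    have hGx : x ⬝ᵥ (G *ᵥ x) = (Q *ᵥ x) ⬝ᵥ (Q *ᵥ x) := by
      rw [hG, ← mulVec_mulVec, dotProduct_mulVec, ← mulVec_transpose, transpose_transpose]
    rw [hB, add_mulVec, sub_mulVec, smul_mulVec, smul_mulVec, dotProduct_add, dotProduct_sub,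
      dotProduct_smul, dotProduct_smul, conj G hGt, hGx]
    have := mul_nonneg (mul_nonneg hc.le hc.le) (hnn (G *ᵥ x))
    simp only [smul_eq_mul]
    linarith
  · have ht : (A * H⁻¹ * A * A⁻¹).trace = p - c * (Q * H⁻¹ * Qᵀ).trace := by
      rw [Matrix.mul_assoc, mul_nonsing_inv _ hAu, Matrix.mul_one]
      conv_lhs => rw [hAH]
      rw [sub_mul, h1, trace_sub, trace_one, Fintype.card_fin, smul_mul_assoc, trace_smul, hG,
        Matrix.mul_assoc, trace_mul_comm, smul_eq_mul]
    rw [ht, trace, Finset.mul_sum]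
    refine sub_le_sub_left (Finset.sum_le_sum fun j _ => ?_) _
    set x := P.col j with hx
    set g := Q.row j with hg
    have hQx : Q *ᵥ x = Pi.single j 1 := by
      rw [hx, ← mulVec_single_one, mulVec_mulVec, hQP, one_mulVec]
    have hgx : g ⬝ᵥ x = 1 := by
      have := congrFun hQx j
      rwa [Pi.single_eq_same] at this
    have hd : (Q * H⁻¹ * Qᵀ).diag j = g ⬝ᵥ (H⁻¹ *ᵥ g) := by
      simp only [diag_apply]
      rw [Matrix.mul_assoc, mul_apply_eq_vecMul]
      simp [vecMul, hg, dotProduct, mul_apply, mulVec]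
    have hxH : x ⬝ᵥ (H *ᵥ x) = x ⬝ᵥ (A *ᵥ x) + c := by
      rw [hH, add_mulVec, smul_mulVec, hG, ← mulVec_mulVec, dotProduct_add, dotProduct_smul,
        dotProduct_mulVec x Qᵀ, ← mulVec_transpose, transpose_transpose, hQx]
      simp
    have hsx : 0 ≤ x ⬝ᵥ (A *ᵥ x) := by
      simpa using hA.posSemidef.dotProduct_mulVec_nonneg x
    set b := x ⬝ᵥ (A *ᵥ x) + c with hb
    have hbpos : 0 < b := by positivity
    have hHt : (H⁻¹)ᵀ = H⁻¹ := by
      simpa [conjTranspose_eq_transpose_of_trivial] using hHinv.isHermitian.eq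
    have key := hHpd.posSemidef.dotProduct_mulVec_nonneg (H⁻¹ *ᵥ g - b⁻¹ • x)
    have e1 : (H⁻¹ *ᵥ g) ⬝ᵥ (H *ᵥ x) = 1 := by
      rw [dotProduct_comm, dotProduct_mulVec, ← mulVec_transpose, hHt, mulVec_mulVec, h2,
        one_mulVec, dotProduct_comm, hgx]
    rw [star_trivial, mulVec_sub, mulVec_smul, mulVec_mulVec, h1, one_mulVec] at key
    simp only [sub_dotProduct, dotProduct_sub, smul_dotProduct, dotProduct_smul, smul_eq_mul, hxH,
      e1] at key
    rw [dotProduct_comm x g, hgx, dotProduct_comm] at key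
    rw [hd, div_eq_mul_inv]
    refine mul_le_mul_of_nonneg_left ?_ hc.le
    have : b⁻¹ * (b⁻¹ * b) = b⁻¹ := by field_simp
    linarith

/-- The trace of a positive semidefinite form is controlled by its values on a basis. -/
theorem trace_le_of_quadForm_col_le {p : ℕ} {A P Q : Matrix (Fin p) (Fin p) ℝ}
    (hA : A.PosSemidef) (hPQ : P * Q = 1) {R : ℝ}
    (hR : ∀ j, P.col j ⬝ᵥ (A *ᵥ P.col j) ≤ R) :
    A.trace ≤ R * ∑ j, ∑ k, |(Q * Qᵀ) j k| := by
  have hAt : Aᵀ = A := by simpa [conjTranspose_eq_transpose_of_trivial] using hA.isHermitian.eq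
  have hent : ∀ j k, |P.col j ⬝ᵥ (A *ᵥ P.col k)| ≤ R := fun j k => by
    have hs : P.col k ⬝ᵥ (A *ᵥ P.col j) = P.col j ⬝ᵥ (A *ᵥ P.col k) := by
      rw [dotProduct_mulVec, ← mulVec_transpose, hAt, dotProduct_comm]
    have h1 := hA.dotProduct_mulVec_nonneg (P.col j - P.col k)
    have h2 := hA.dotProduct_mulVec_nonneg (P.col j + P.col k)
    simp only [star_trivial, mulVec_sub, mulVec_add, sub_dotProduct, dotProduct_sub,
      add_dotProduct, dotProduct_add, hs] at h1 h2
    have := hR j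
    have := hR k
    rw [abs_le]
    constructor <;> linarith
  have htr : A.trace = ∑ j, ∑ k, (P.col j ⬝ᵥ (A *ᵥ P.col k)) * (Q * Qᵀ) j k := by
    have hQP : Qᵀ * Pᵀ = 1 := by rw [← transpose_mul, hPQ, transpose_one]
    have : A.trace = ((Pᵀ * A * P) * (Q * Qᵀ)).trace := by
      rw [show (Pᵀ * A * P) * (Q * Qᵀ) = Pᵀ * (A * (P * Q) * Qᵀ) by simp only [Matrix.mul_assoc],
        hPQ, Matrix.mul_one, trace_mul_comm, Matrix.mul_assoc, hQP, Matrix.mul_one]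
    have hS : ∀ j k, (Q * Qᵀ) k j = (Q * Qᵀ) j k := fun j k => by
      simp [mul_apply, mul_comm]
    rw [this, trace]
    refine Finset.sum_congr rfl fun j _ => ?_
    rw [diag_apply, mul_apply]
    refine Finset.sum_congr rfl fun k _ => ?_
    rw [hS, Matrix.mul_assoc]
    rfl
  rw [htr, Finset.mul_sum]
  refine Finset.sum_le_sum fun j _ => ?_
  rw [Finset.mul_sum]
  refine Finset.sum_le_sum fun k _ => (le_abs_self _).trans ?_
  rw [abs_mul]
  exact mul_le_mul_of_nonneg_right (hent j k) (abs_nonneg _)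

/-- An increasing chain `T 0 ⊆ ⋯ ⊆ T p` of finite sets is either stationary at some step or ends in a set
with at least `p` elements. -/
theorem Monotone.exists_eq_succ_or_le_card {α : Type*} {T : ℕ → Finset α} (hT : Monotone T)
    (p : ℕ) : (∃ j < p, T j = T (j + 1)) ∨ p ≤ (T p).card := by
  induction p with
  | zero => exact Or.inr (Nat.zero_le _)
  | succ k ih =>
    rcases ih with ⟨j, hj, h⟩ | h
    · exact Or.inl ⟨j, hj.trans (Nat.lt_succ_self k), h⟩
    · by_cases he : T k = T (k + 1)
      · exact Or.inl ⟨k, Nat.lt_succ_self k, he⟩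
      · exact Or.inr
          (h.trans_lt (Finset.card_lt_card ((hT (Nat.le_succ k)).ssubset_of_ne he)))

theorem Cond21.exists_forall_le_psi {p : ℕ} {u : ℝ → ℝ} {K : ℝ} (hu : Cond21 p u K) {a : ℝ}
    (ha : a < K) : ∃ R, 0 < R ∧ ∀ s, R ≤ s → a ≤ s * u s := by
  obtain ⟨y, ⟨R, hR, rfl⟩, hy, -⟩ := hu.psi_lub.exists_between ha
  exact ⟨R, hR, fun s hs => hy.le.trans (hu.psi_mono hR hs)⟩

/-- A margin `δ` making the limiting counting inequality strict, uniformly in `r`. -/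
theorem exists_margin {p n : ℕ} {N K : ℝ} (hN : 0 < N) (hpn : p ≤ n)
    (h : p * N < n * K) : ∃ δ : ℝ, 0 < δ ∧ δ < 1 ∧ ∀ r : ℕ, r < p →
      N * (p - r * (1 - δ)) < (n - r) * (K * (1 - δ) * (1 - δ)) := by
  have hev : ∀ᶠ δ : ℝ in nhdsWithin 0 (Set.Ioi 0), ∀ r ∈ Finset.range p,
      N * (p - r * (1 - δ)) < (n - r) * (K * (1 - δ) * (1 - δ)) := by
    rw [Filter.eventually_all_finset]
    intro r hr
    refine nhdsWithin_le_nhds (ContinuousAt.eventually_lt (by fun_prop) (by fun_prop) ?_)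
    have hr' : (r : ℝ) < p := by exact_mod_cast Finset.mem_range.1 hr
    have hpn' : (p : ℝ) ≤ n := by exact_mod_cast hpn
    have h0 : (0 : ℝ) ≤ r := Nat.cast_nonneg r
    have hn0 : (0 : ℝ) < n := by linarith
    have h1 : 0 < ((n : ℝ) - r) * (n * K - p * N) := mul_pos (by linarith) (by linarith)
    have h2 : 0 ≤ N * r * ((n : ℝ) - p) := by
      have : (0 : ℝ) ≤ n - p := by linarith
      positivity
    simp only [sub_zero, mul_one]
    refine lt_of_mul_lt_mul_left ?_ hn0.le
    linarith
  obtain ⟨δ, h1, h2, h3⟩ := (hev.and (Ioo_mem_nhdsGT (zero_lt_one' ℝ))).exists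
  exact ⟨δ, h2, h3, fun r hr => h1 r (Finset.mem_range.2 hr)⟩

/-- The counting inequality at a scale gap: the points of `X` split into those with squared
Mahalanobis length at most `R` (indexed by `T`) and those above `R * (M / δ ^ 2)`. -/
theorem IsScatterMEstimate.counting_le {p n m : ℕ} {t : Fin p → ℝ} {u : ℝ → ℝ} {K : ℝ}
    (hu : Cond21 p u K) {X : Fin n → Fin p → ℝ} {Y : Fin m → Fin p → ℝ}
    {V : Matrix (Fin p) (Fin p) ℝ} (hV : IsScatterMEstimate u t (Fin.append X Y) V)
    (hN : (0 : ℝ) < (n + m : ℕ)) {f : Fin p → Fin n} (hf : Function.Injective f)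
    {Q : Matrix (Fin p) (Fin p) ℝ} (hQ : Q * (of fun j => X (f j) - t)ᵀ = 1)
    {M δ R : ℝ} (hδ : 0 < δ) (hδ1 : δ < 1) (hR : 0 < R) (hM : 0 < M)
    (hQM : ∀ i, (Q *ᵥ (X i - t)) ⬝ᵥ (Q *ᵥ (X i - t)) ≤ M) {T : Finset (Fin n)}
    (hTf : ∀ i ∈ T, ∃ j, f j = i)
    (hT : ∀ i ∈ T, (X i - t) ⬝ᵥ (V⁻¹ *ᵥ (X i - t)) ≤ R)
    (hT' : ∀ i ∉ T, R * (M / δ ^ 2) < (X i - t) ⬝ᵥ (V⁻¹ *ᵥ (X i - t)))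
    (hpsi : ∀ s, R * (M / δ ^ 2) ≤ s → K * (1 - δ) ≤ s * u s) :
    (n - T.card) * (K * (1 - δ) * (1 - δ)) ≤ (n + m : ℕ) * (p - T.card * (1 - δ)) := by
  classical
  obtain ⟨hVpd, hVeq⟩ := hV
  set c := R / δ with hc
  have hcpos : 0 < c := by positivity
  set q : (Fin p → ℝ) → ℝ := fun x => x ⬝ᵥ (V⁻¹ *ᵥ x) with hq
  have hqpos : ∀ x, x ≠ 0 → 0 < q x := fun x hx => by
    simpa using hVpd.inv.dotProduct_mulVec_pos hx
  have hqnn : ∀ x, 0 ≤ q x := fun x => by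
    simpa using hVpd.inv.posSemidef.dotProduct_mulVec_nonneg x
  obtain ⟨B, hB0, hB1, hBtr⟩ := exists_posSemidef_truncation hVpd.inv hQ hcpos
  rw [nonsing_inv_nonsing_inv _ ((isUnit_iff_isUnit_det _).1 hVpd.isUnit)] at hBtr
  set z := Fin.append X Y with hz
  set φ : (Fin p → ℝ) → ℝ := fun y =>
    if y = t then 0 else u (q (y - t)) * ((y - t) ⬝ᵥ (B *ᵥ (y - t))) with hφ
  have hφnn : ∀ y, 0 ≤ φ y := fun y => by
    simp only [hφ]
    split_ifs with h
    · exact le_rfl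
    · exact mul_nonneg (hu.nonneg (hqpos _ (sub_ne_zero.2 h))) (hB0 _)
  have hsum : ∑ i, φ (z i) = (n + m : ℕ) * (B * V).trace := by
    have e : (n + m : ℕ) * (B * V).trace = (B * (((n + m : ℕ) : ℝ) • V)).trace := by
      rw [mul_smul_comm, trace_smul, smul_eq_mul]
    rw [e]
    conv_rhs => rw [hVeq]
    rw [smul_smul, mul_inv_cancel₀ hN.ne', one_smul, Matrix.mul_sum, trace_sum]
    refine Finset.sum_congr rfl fun i _ => ?_
    simp only [hφ]
    split_ifs with h
    · simp
    · rw [mul_smul_comm, trace_smul, smul_eq_mul, mul_vecMulVec, trace_vecMulVec,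
        dotProduct_comm]
  have hlow : ∀ i ∉ T, K * (1 - δ) * (1 - δ) ≤ φ (X i) := fun i hi => by
    have hs := hT' i hi
    set s := (X i - t) ⬝ᵥ (V⁻¹ *ᵥ (X i - t)) with hs'
    have hspos : 0 < s := lt_trans (by positivity) hs
    have hne : X i ≠ t := fun h => by simp [hs', h] at hspos
    have hu0 := hu.nonneg hspos
    have h1 : (1 - δ) * s ≤ (X i - t) ⬝ᵥ (B *ᵥ (X i - t)) := by
      refine le_trans ?_ (hB1 _)
      have h2 : c * M = δ * (R * (M / δ ^ 2)) := by rw [hc]; field_simp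
      have h3 := mul_le_mul_of_nonneg_left (hQM i) hcpos.le
      have h4 := mul_le_mul_of_nonneg_left hs.le hδ.le
      linarith
    simp only [hφ, if_neg hne]
    calc K * (1 - δ) * (1 - δ) ≤ s * u s * (1 - δ) :=
          mul_le_mul_of_nonneg_right (hpsi s hs.le) (by linarith)
      _ = u s * ((1 - δ) * s) := by ring
      _ ≤ _ := mul_le_mul_of_nonneg_left h1 hu0
  have hleft : (n - T.card) * (K * (1 - δ) * (1 - δ)) ≤ ∑ i, φ (z i) := by
    rw [Fin.sum_univ_add]
    simp only [hz, Fin.append_left, Fin.append_right]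
    have h1 : 0 ≤ ∑ i, φ (Y i) := Finset.sum_nonneg fun i _ => hφnn _
    have h2 : ∑ i ∈ Tᶜ, φ (X i) ≤ ∑ i, φ (X i) :=
      Finset.sum_le_sum_of_subset_of_nonneg (Finset.subset_univ _) fun i _ _ => hφnn _
    have h3 := Finset.card_nsmul_le_sum Tᶜ (fun i => φ (X i)) (K * (1 - δ) * (1 - δ))
      fun i hi => hlow i (Finset.mem_compl.1 hi)
    have h4 : ((Tᶜ.card : ℕ) : ℝ) = n - T.card := by
      rw [Finset.card_compl, Fintype.card_fin, Nat.cast_sub (by simpa using T.card_le_univ)]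
    rw [nsmul_eq_mul, h4] at h3
    linarith
  refine hleft.trans (hsum.trans_le (mul_le_mul_of_nonneg_left (hBtr.trans ?_) hN.le))
  refine sub_le_sub_left ?_ _
  have h5 : ∑ j, c / (q (X (f j) - t) + c) = ∑ i ∈ univ.image f, c / (q (X i - t) + c) :=
    (Finset.sum_image (f := fun i => c / (q (X i - t) + c)) fun a _ b _ h => hf h).symm
  have h6 : T ⊆ univ.image f := fun i hi => by
    obtain ⟨j, hj⟩ := hTf i hi
    exact Finset.mem_image.2 ⟨j, Finset.mem_univ _, hj⟩
  have h7 : ∑ i ∈ T, c / (q (X i - t) + c) ≤ ∑ i ∈ univ.image f, c / (q (X i - t) + c) :=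
    Finset.sum_le_sum_of_subset_of_nonneg h6 fun i _ _ =>
      div_nonneg hcpos.le (add_nonneg (hqnn _) hcpos.le)
  have h8 := Finset.card_nsmul_le_sum T (fun i => c / (q (X i - t) + c)) (1 - δ) fun i hi => by
    have := hqnn (X i - t)
    rw [le_div_iff₀ (by positivity)]
    have h9 : q (X i - t) ≤ δ * c := by
      rw [hc, mul_div_cancel₀ _ hδ.ne']; exact hT i hi
    nlinarith
  rw [nsmul_eq_mul] at h8
  refine (h8.trans h7).trans (h5.symm.le.trans (le_of_eq ?_))
  rfl

/-- Lemma 3.2.i: if `ε_m = m/(n+m) < 1 - p/K`, then `trace(V⁻¹)` is bounded above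
uniformly over all contaminating lists `Y` and all M-estimates `V` for `X ∪ Y`. -/
theorem statement5 (p n m : ℕ) (hp : 1 ≤ p) (hm : 1 ≤ m) (hn : p * (p - 1) < n)
    (t : Fin p → ℝ) (u : ℝ → ℝ) (K : ℝ) (hu : Cond21 p u K)
    (X : Fin n → Fin p → ℝ) (hX : GenPosAbout t X)
    (heps : (m : ℝ) / ((n : ℝ) + m) < 1 - (p : ℝ) / K) :
    ∃ C : ℝ, ∀ Y : Fin m → Fin p → ℝ, ∀ V : Matrix (Fin p) (Fin p) ℝ,
      IsScatterMEstimate u t (Fin.append X Y) V → (V⁻¹).trace ≤ C := by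
  classical
  have hpn : p ≤ n := by
    rcases Nat.lt_or_ge p 2 with h | h
    · omega
    · have := Nat.mul_le_mul_left p (show 1 ≤ p - 1 by omega)
      omega
  have hK : 0 < K := (Nat.cast_nonneg p).trans_lt hu.K_gt_p
  have hN : (0 : ℝ) < (n + m : ℕ) := by exact_mod_cast (by omega : 0 < n + m)
  have hpN : (p : ℝ) * (n + m : ℕ) < n * K := by
    push_cast at hN ⊢
    rw [div_lt_iff₀ hN] at heps
    have : (p : ℝ) / K * (n + m) < n := by linarith
    rwa [div_mul_eq_mul_div, div_lt_iff₀ hK] at this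
  obtain ⟨δ, hδ, hδ1, hmargin⟩ := exists_margin hN hpn hpN
  obtain ⟨R₀, hR₀, hpsi⟩ := hu.exists_forall_le_psi (a := K * (1 - δ)) (by nlinarith)
  set P : (Fin p → Fin n) → Matrix (Fin p) (Fin p) ℝ :=
    fun f => (of fun j => X (f j) - t)ᵀ with hP
  have hPu : ∀ f, Function.Injective f → IsUnit (P f).det := fun f hf => by
    rw [hP, det_transpose, ← isUnit_iff_isUnit_det, ← linearIndependent_rows_iff_isUnit]
    exact hX f hf
  set W : (Fin p → Fin n) → Fin n → ℝ :=
    fun f i => ((P f)⁻¹ *ᵥ (X i - t)) ⬝ᵥ ((P f)⁻¹ *ᵥ (X i - t)) with hW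
  have hWnn : ∀ f i, 0 ≤ W f i := fun f i => by
    simpa using dotProduct_star_self_nonneg ((P f)⁻¹ *ᵥ (X i - t))
  set M : ℝ := 1 + ∑ f, ∑ i, W f i with hM
  have hWM : ∀ f i, W f i ≤ M := fun f i => by
    have h1 := Finset.single_le_sum (fun i _ => hWnn f i) (Finset.mem_univ i)
    have h2 := Finset.single_le_sum (f := fun f => ∑ i, W f i)
      (fun f _ => Finset.sum_nonneg fun i _ => hWnn f i) (Finset.mem_univ f)
    linarith
  have hM1 : 1 ≤ M := by
    have : 0 ≤ ∑ f, ∑ i, W f i :=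
      Finset.sum_nonneg fun f _ => Finset.sum_nonneg fun i _ => hWnn f i
    linarith
  have hL1 : 1 ≤ M / δ ^ 2 := by
    rw [le_div_iff₀ (by positivity)]
    nlinarith
  set S : (Fin p → Fin n) → ℝ := fun f => ∑ j, ∑ k, |((P f)⁻¹ * ((P f)⁻¹)ᵀ) j k| with hS
  have hSnn : ∀ f, 0 ≤ S f := fun f =>
    Finset.sum_nonneg fun _ _ => Finset.sum_nonneg fun _ _ => abs_nonneg _
  refine ⟨R₀ * (M / δ ^ 2) ^ p * ∑ f, S f, fun Y V hV => ?_⟩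
  set T : ℕ → Finset (Fin n) := fun k =>
    univ.filter fun i => (X i - t) ⬝ᵥ (V⁻¹ *ᵥ (X i - t)) ≤ R₀ * (M / δ ^ 2) ^ k with hT
  have hRmono : Monotone fun k : ℕ => R₀ * (M / δ ^ 2) ^ k := fun a b hab =>
    mul_le_mul_of_nonneg_left (pow_le_pow_right₀ hL1 hab) hR₀.le
  have hTmono : Monotone T := fun a b hab i hi => by
    simp only [hT, Finset.mem_filter, Finset.mem_univ, true_and] at hi ⊢
    exact hi.trans (hRmono hab)
  have henum : ∀ U : Finset (Fin n), U.card = p →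
      ∃ f : Fin p → Fin n, Function.Injective f ∧ Set.range f = U := fun U hU =>
    ⟨U.orderEmbOfFin hU, (U.orderEmbOfFin hU).injective, U.range_orderEmbOfFin hU⟩
  rcases lt_or_ge (T p).card p with hcard | hcard
  · exfalso
    obtain ⟨k, hkp, hk⟩ := (hTmono.exists_eq_succ_or_le_card p).resolve_right hcard.not_ge
    have hTk : (T k).card < p := (Finset.card_le_card (hTmono hkp.le)).trans_lt hcard
    obtain ⟨U, hTU, hU⟩ := Finset.exists_superset_card_eq hTk.le (by simpa using hpn)
    obtain ⟨f, hf, hfU⟩ := henum U hU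
    have hstep : R₀ * (M / δ ^ 2) ^ k * (M / δ ^ 2) = R₀ * (M / δ ^ 2) ^ (k + 1) := by ring
    have hR₀' : R₀ ≤ R₀ * (M / δ ^ 2) ^ (k + 1) := by simpa using hRmono (Nat.zero_le (k + 1))
    refine (hmargin _ hTk).not_ge
      (hV.counting_le hu hN hf (nonsing_inv_mul _ (hPu f hf)) hδ hδ1
        (R := R₀ * (M / δ ^ 2) ^ k) (by positivity) (by linarith) (hWM f) (fun i hi => ?_)
        (fun i hi => ?_) (fun i hi => ?_) fun s hs => ?_)
    · have : i ∈ Set.range f := by rw [hfU]; exact hTU hi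
      exact this
    · simpa [hT] using hi
    · rw [hk] at hi
      rw [hstep]
      simpa only [hT, Finset.mem_filter, Finset.mem_univ, true_and, not_le] using hi
    · rw [hstep] at hs
      exact hpsi s (hR₀'.trans hs)
  · obtain ⟨U, hUT, hU⟩ := Finset.exists_subset_card_eq hcard
    obtain ⟨f, hf, hfU⟩ := henum U hU
    have hfT : ∀ j, f j ∈ T p := fun j => hUT (by
      have : f j ∈ Set.range f := ⟨j, rfl⟩
      rwa [hfU] at this)
    refine (trace_le_of_quadForm_col_le hV.1.inv.posSemidef (mul_nonsing_inv _ (hPu f hf))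
      (R := R₀ * (M / δ ^ 2) ^ p) fun j => ?_).trans
      (mul_le_mul_of_nonneg_left
        (Finset.single_le_sum (fun f _ => hSnn f) (Finset.mem_univ f)) (by positivity))
    have := hfT j
    simp only [hT, Finset.mem_filter, Finset.mem_univ, true_and] at this
    exact this
end
end

section
/- Suppose u satisfies Condition 2.1 with constant K, r > 0, and ε_m = m/(n+m) < 1 − n(p−1)/((n−1)K). Then there exists a constant C < ∞, depending only on X, u, m and r, such that for every Y ∈ C_{2,r,m}(X) and every M-estimate of scatter V for Z = X ∪ Y about t, trace(V⁻¹) ≤ C. -/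
open Matrix Finset Filter

noncomputable section

/-- Spectral data of a positive definite matrix, written with dot products. -/
lemma Matrix.PosDef.exists_spectral {p : ℕ} {V : Matrix (Fin p) (Fin p) ℝ} (hV : V.PosDef) :
    ∃ (b : Fin p → Fin p → ℝ) (l : Fin p → ℝ), (∀ a, 0 < l a) ∧
      (∀ d, d ⬝ᵥ d = ∑ a, (b a ⬝ᵥ d) ^ 2) ∧
      (∀ a, b a ⬝ᵥ (V *ᵥ b a) = l a) ∧
      (∀ d, d ⬝ᵥ (V⁻¹ *ᵥ d) = ∑ a, (b a ⬝ᵥ d) ^ 2 / l a) ∧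
      V⁻¹.trace = ∑ a, (l a)⁻¹ := by
  set l := hV.isHermitian.eigenvalues with hl
  set U : Matrix (Fin p) (Fin p) ℝ :=
    (hV.isHermitian.eigenvectorUnitary : Matrix (Fin p) (Fin p) ℝ) with hU
  have hUU : Uᵀ * U = 1 := by
    have := Unitary.coe_star_mul_self hV.isHermitian.eigenvectorUnitary
    rwa [star_eq_conjTranspose, conjTranspose_eq_transpose_of_trivial] at this
  have hUU' : U * Uᵀ = 1 := mul_eq_one_comm.mp hUU
  have hpos : ∀ a, 0 < l a := hV.eigenvalues_pos
  have hspec : V = U * diagonal l * Uᵀ := by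
    have := hV.isHermitian.spectral_theorem
    rw [Unitary.conjStarAlgAut_apply, star_eq_conjTranspose,
      conjTranspose_eq_transpose_of_trivial] at this
    exact this
  have hinv : V⁻¹ = U * diagonal (fun a => (l a)⁻¹) * Uᵀ := by
    apply inv_eq_right_inv
    calc V * (U * diagonal (fun a => (l a)⁻¹) * Uᵀ)
        = U * diagonal l * (Uᵀ * U) * diagonal (fun a => (l a)⁻¹) * Uᵀ := by
          rw [hspec]; simp only [Matrix.mul_assoc]
      _ = U * (diagonal l * diagonal (fun a => (l a)⁻¹)) * Uᵀ := by
          rw [hUU, Matrix.mul_one]; simp only [Matrix.mul_assoc]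
      _ = 1 := by
          rw [diagonal_mul_diagonal]
          simp [mul_inv_cancel₀ (hpos _).ne', hUU']
  have hquad : ∀ (w : Fin p → ℝ) (d : Fin p → ℝ),
      d ⬝ᵥ ((U * diagonal w * Uᵀ) *ᵥ d) = ∑ a, w a * ((Uᵀ *ᵥ d) a) ^ 2 := by
    intro w d
    rw [← mulVec_mulVec, ← mulVec_mulVec, dotProduct_mulVec, ← mulVec_transpose]
    simp only [dotProduct, mulVec_diagonal]
    exact Finset.sum_congr rfl fun a _ => by ring
  have hb : ∀ a d, Uᵀ a ⬝ᵥ d = (Uᵀ *ᵥ d) a := fun _ _ => rfl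
  refine ⟨fun a => Uᵀ a, l, hpos, fun d => ?_, fun a => ?_, fun d => ?_, ?_⟩
  · have := hquad 1 d
    have h1 : diagonal (1 : Fin p → ℝ) = 1 := diagonal_one
    simpa [h1, hUU', hb] using this
  · have hcol : Uᵀ *ᵥ (Uᵀ a) = Pi.single a 1 := by
      have : Uᵀ a = U *ᵥ Pi.single a 1 := by ext; simp [Matrix.col_apply]
      rw [this, mulVec_mulVec, hUU, one_mulVec]
    rw [hspec, hquad, hcol]
    simp [Pi.single_apply]
  · rw [hinv, hquad]
    exact Finset.sum_congr rfl fun a _ => by rw [hb]; ring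
  · rw [hinv, Matrix.trace_mul_comm, ← Matrix.mul_assoc, hUU, Matrix.one_mul, trace_diagonal]

/-- If some of `p` reals is at most `η ^ (p + 1)`, there is a multiplicative gap `(η τ, τ]`
with `τ ≤ η` that contains none of them. -/
lemma exists_gap {p : ℕ} (l : Fin p → ℝ) {η : ℝ} (h0 : 0 < η) (h1 : η < 1)
    (h : ∃ a, l a ≤ η ^ (p + 1)) :
    ∃ τ, 0 < τ ∧ τ ≤ η ∧ (∃ a, l a ≤ η * τ) ∧ ∀ a, l a ≤ η * τ ∨ τ < l a := by
  obtain ⟨a₀, ha₀⟩ := h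
  by_contra! hcon
  have key : ∀ k : Fin p, ∃ a, η ^ (k.1 + 2) < l a ∧ l a ≤ η ^ (k.1 + 1) := by
    intro k
    have hle : l a₀ ≤ η * η ^ (k.1 + 1) := by
      rw [← pow_succ']
      exact ha₀.trans (pow_le_pow_of_le_one h0.le h1.le (by omega))
    have hτ : η ^ (k.1 + 1) ≤ η := by
      simpa using pow_le_pow_of_le_one h0.le h1.le (show 1 ≤ k.1 + 1 by omega)
    obtain ⟨a, ha, ha'⟩ := hcon (η ^ (k.1 + 1)) (by positivity) hτ ⟨a₀, hle⟩
    exact ⟨a, by rwa [← pow_succ'] at ha, ha'⟩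
  choose f hf hf' using key
  have hmono : ∀ i j : Fin p, i < j → f i ≠ f j := by
    intro i j hij he
    have h2 : η ^ (j.1 + 1) ≤ η ^ (i.1 + 2) :=
      pow_le_pow_of_le_one h0.le h1.le (by have : i.1 < j.1 := hij; omega)
    have := hf i
    have := hf' j
    rw [he] at *
    linarith
  have hinj : Function.Injective f := by
    intro i j he
    rcases lt_trichotomy i j with h | h | h
    · exact absurd he (hmono i j h)
    · exact h
    · exact absurd he.symm (hmono j i h)
  obtain ⟨k, hk⟩ := (Finite.injective_iff_surjective.mp hinj) a₀
  have h2 : η ^ (p + 1) ≤ η ^ (k.1 + 2) := pow_le_pow_of_le_one h0.le h1.le (by omega)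
  have := hf k
  rw [hk] at this
  linarith

/-- The defining equation of an M-estimate, tested against a vector. -/
lemma IsScatterMEstimate.dotProduct_mulVec {p N : ℕ} {u : ℝ → ℝ} {t : Fin p → ℝ}
    {z : Fin N → Fin p → ℝ} {V : Matrix (Fin p) (Fin p) ℝ} (h : IsScatterMEstimate u t z V)
    (b : Fin p → ℝ) :
    b ⬝ᵥ (V *ᵥ b) = (N : ℝ)⁻¹ * ∑ i,
      u ((z i - t) ⬝ᵥ (V⁻¹ *ᵥ (z i - t))) * (b ⬝ᵥ (z i - t)) ^ 2 := by
  conv_lhs => rw [h.2]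
  rw [smul_mulVec, dotProduct_smul, smul_eq_mul, sum_mulVec, dotProduct_sum]
  congr 1
  refine Finset.sum_congr rfl fun i _ => ?_
  split_ifs with hi
  · simp [hi]
  · rw [smul_mulVec, dotProduct_smul, vecMulVec_mulVec, smul_eq_mul, op_smul_eq_smul,
      dotProduct_smul, smul_eq_mul, dotProduct_comm (z i - t) b, sq]

/-- A finite linearly independent family is quantitatively linearly independent. -/
lemma LinearIndependent.exists_pos_mul_le {ι : Type*} [Fintype ι] {p : ℕ}
    {v : ι → Fin p → ℝ} (hv : LinearIndependent ℝ v) :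
    ∃ c > 0, ∀ α : ι → ℝ,
      c * ∑ i, α i ^ 2 ≤ (∑ i, α i • v i) ⬝ᵥ (∑ i, α i • v i) := by
  have hker : LinearMap.ker (Fintype.linearCombination ℝ v) = ⊥ :=
    LinearMap.ker_eq_bot.mpr (linearIndependent_iff_injective_fintypeLinearCombination.mp hv)
  obtain ⟨L, hL, hanti⟩ := LinearMap.exists_antilipschitzWith _ hker
  have hL' : (0 : ℝ) < L := hL
  refine ⟨((Fintype.card ι + 1) * (L : ℝ) ^ 2)⁻¹, by positivity, fun α => ?_⟩
  set w := ∑ i, α i • v i with hw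
  have h1 : ‖α‖ ≤ L * ‖w‖ := by
    have := hanti.le_mul_dist α 0
    simpa [Fintype.linearCombination_apply, hw] using this
  have h2 : ∑ i, α i ^ 2 ≤ Fintype.card ι * ‖α‖ ^ 2 := by
    have : ∀ i ∈ Finset.univ, α i ^ 2 ≤ ‖α‖ ^ 2 := fun i _ => by
      rw [← sq_abs]
      exact pow_le_pow_left₀ (abs_nonneg _) (norm_le_pi_norm α i) 2
    simpa using Finset.sum_le_card_nsmul _ _ _ this
  have h3 : ‖w‖ ^ 2 ≤ w ⬝ᵥ w := by
    have hnn : 0 ≤ w ⬝ᵥ w := Finset.sum_nonneg fun i _ => mul_self_nonneg _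
    rw [← Real.le_sqrt (norm_nonneg _) hnn, pi_norm_le_iff_of_nonneg (Real.sqrt_nonneg _)]
    intro j
    refine Real.abs_le_sqrt ?_
    rw [sq]
    exact Finset.single_le_sum (f := fun i => w i * w i) (fun i _ => mul_self_nonneg _)
      (Finset.mem_univ j)
  rw [inv_mul_le_iff₀ (by positivity)]
  calc ∑ i, α i ^ 2 ≤ Fintype.card ι * ‖α‖ ^ 2 := h2
    _ ≤ (Fintype.card ι + 1) * (L * ‖w‖) ^ 2 := by gcongr; linarith
    _ = (Fintype.card ι + 1) * L ^ 2 * ‖w‖ ^ 2 := by ring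
    _ ≤ _ := by gcongr

lemma GenPosAbout.linearIndependent {p n : ℕ} {t : Fin p → ℝ} {X : Fin n → Fin p → ℝ}
    (hX : GenPosAbout t X) (hpn : p ≤ n) {T : Finset (Fin n)} (hT : #T ≤ p) :
    LinearIndependent ℝ (fun i : T => X i - t) := by
  obtain ⟨T', hTT', hT'⟩ := Finset.exists_superset_card_eq hT (by simpa using hpn)
  let e : T' ≃ Fin p := T'.equivFinOfCardEq hT'
  have h1 := hX (fun j => (e.symm j : Fin n))
    (Subtype.val_injective.comp e.symm.injective)
  have h2 := h1.comp e e.injective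
  have h3 := h2.comp (fun i : T => (⟨i, hTT' i.2⟩ : T'))
    (fun i j h => Subtype.ext (by simpa using h))
  simpa [Function.comp_def] using h3

/-- For points in general position, only `p - q` of them can be close to the orthogonal
complement of a `q`-dimensional subspace. -/
lemma GenPosAbout.exists_card_add_card_le {p n : ℕ} {t : Fin p → ℝ} {X : Fin n → Fin p → ℝ}
    (hX : GenPosAbout t X) (hpn : p ≤ n) :
    ∃ δ > 0, ∀ b : Fin p → Fin p → ℝ, (∀ d, d ⬝ᵥ d = ∑ a, (b a ⬝ᵥ d) ^ 2) →
      ∀ A : Finset (Fin p), A.Nonempty →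
        #{i | ∑ a ∈ A, (b a ⬝ᵥ (X i - t)) ^ 2 < δ} + #A ≤ p := by
  have hc : ∀ T : Finset (Fin n), ∃ c > 0, #T ≤ p → ∀ α : T → ℝ,
      c * ∑ i, α i ^ 2 ≤ (∑ i, α i • (X i - t)) ⬝ᵥ (∑ i, α i • (X i - t)) := by
    intro T
    by_cases hT : #T ≤ p
    · obtain ⟨c, hc, h⟩ := (hX.linearIndependent hpn hT).exists_pos_mul_le
      exact ⟨c, hc, fun _ => h⟩
    · exact ⟨1, one_pos, fun h => absurd h hT⟩
  choose c hc0 hc using hc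
  obtain ⟨T₀, -, hT₀⟩ := Finset.exists_min_image Finset.univ c ⟨∅, Finset.mem_univ _⟩
  refine ⟨c T₀ / (n + 1), div_pos (hc0 _) (by positivity), fun b hb A hA => ?_⟩
  set δ := c T₀ / (n + 1) with hδ
  have hδc : δ * (n + 1) = c T₀ := by rw [hδ]; field_simp
  have hδ0 : 0 < δ := div_pos (hc0 _) (by positivity)
  by_contra! hcon
  have hA1 : 1 ≤ #A := hA.card_pos
  have hAp : #A ≤ p := by simpa using Finset.card_le_univ A
  obtain ⟨T, hTsub, hTcard⟩ := Finset.exists_subset_card_eq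
    (show p - #A + 1 ≤ #{i | ∑ a ∈ A, (b a ⬝ᵥ (X i - t)) ^ 2 < δ} by omega)
  let g : (T → ℝ) →ₗ[ℝ] ((Aᶜ : Finset (Fin p)) → ℝ) :=
    Fintype.linearCombination ℝ (fun (i : T) (a : (Aᶜ : Finset (Fin p))) => b a ⬝ᵥ (X i - t))
  have hker : LinearMap.ker g ≠ ⊥ := by
    apply LinearMap.ker_ne_bot_of_finrank_lt
    simp only [Module.finrank_fintype_fun_eq_card, Fintype.card_coe, Finset.card_compl,
      Fintype.card_fin, hTcard]
    omega
  obtain ⟨α, hα, hα0⟩ := Submodule.exists_mem_ne_zero_of_ne_bot hker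
  have hαsq : 0 < ∑ i, α i ^ 2 := by
    obtain ⟨i, hi⟩ := Function.ne_iff.mp hα0
    exact Finset.sum_pos' (fun _ _ => sq_nonneg _) ⟨i, Finset.mem_univ _, by
      have : α i ≠ 0 := hi
      positivity⟩
  set w := ∑ i, α i • (X i - t) with hw
  have hbw : ∀ a, b a ⬝ᵥ w = ∑ i, α i * (b a ⬝ᵥ (X i - t)) := fun a => by
    simp [hw, dotProduct_sum]
  have hcompl : ∀ a ∉ A, b a ⬝ᵥ w = 0 := by
    intro a ha
    have := congrFun (LinearMap.mem_ker.mp hα) ⟨a, by simpa using ha⟩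
    simpa [g, Fintype.linearCombination_apply, hbw] using this
  have hww : w ⬝ᵥ w ≤ (∑ i, α i ^ 2) * (n * δ) := by
    calc w ⬝ᵥ w = ∑ a ∈ A, (b a ⬝ᵥ w) ^ 2 := by
          rw [hb]
          refine (Finset.sum_subset (Finset.subset_univ A) fun a _ ha => ?_).symm
          rw [hcompl a ha]; simp
      _ ≤ ∑ a ∈ A, (∑ i, α i ^ 2) * ∑ i : T, (b a ⬝ᵥ (X i - t)) ^ 2 := by
          refine Finset.sum_le_sum fun a _ => ?_
          rw [hbw]
          exact Finset.sum_mul_sq_le_sq_mul_sq _ _ _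
      _ = (∑ i, α i ^ 2) * ∑ i : T, ∑ a ∈ A, (b a ⬝ᵥ (X i - t)) ^ 2 := by
          rw [← Finset.mul_sum, Finset.sum_comm]
      _ ≤ (∑ i, α i ^ 2) * (n * δ) := by
          gcongr
          calc ∑ i : T, ∑ a ∈ A, (b a ⬝ᵥ (X i - t)) ^ 2 ≤ ∑ i : T, δ :=
                Finset.sum_le_sum fun i _ => (Finset.mem_filter.mp (hTsub i.2)).2.le
            _ = #T * δ := by simp
            _ ≤ n * δ := by
                gcongr
                simpa using Finset.card_le_univ T
  have h1 := hc T (by omega) α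
  have h2 := hT₀ T (Finset.mem_univ _)
  have h3 : c T₀ * ∑ i, α i ^ 2 ≤ c T * ∑ i, α i ^ 2 := by gcongr
  have h4 : (∑ i, α i ^ 2) * (δ * (n + 1)) ≤ (∑ i, α i ^ 2) * (n * δ) := by
    rw [hδc]; linarith
  have h5 := le_of_mul_le_mul_left h4 hαsq
  linarith

lemma Cond21.exists_forall_le {p : ℕ} {u : ℝ → ℝ} {K κ : ℝ} (hu : Cond21 p u K) (hκ : κ < K) :
    ∃ s₀ > 0, ∀ s ≥ s₀, κ ≤ s * u s := by
  obtain ⟨y, ⟨s₀, hs₀, rfl⟩, hy, -⟩ := hu.psi_lub.exists_between hκ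
  exact ⟨s₀, hs₀, fun s hs => hy.le.trans (hu.psi_mono hs₀ hs)⟩

/-- A threshold strictly between the two critical ratios and `K`. -/
lemma exists_threshold {p n m : ℕ} (hn : p * (p - 1) < n) {K : ℝ}
    (hK : (p : ℝ) < K)
    (heps : (m : ℝ) / ((n : ℝ) + m)
      < 1 - (n : ℝ) * ((p : ℝ) - 1) / (((n : ℝ) - 1) * K)) :
    ∃ w, (p : ℝ) < w ∧ w < K ∧
      (2 ≤ p → ((p : ℝ) - 1) * ((n : ℝ) + m) < ((n : ℝ) - 1) * w) := by
  have hp0 : (0 : ℝ) ≤ p := Nat.cast_nonneg p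
  by_cases h2 : 2 ≤ p
  · have hn2 : 2 ≤ n := by
      have : 2 * 1 ≤ p * (p - 1) := Nat.mul_le_mul h2 (by omega)
      omega
    have hn' : (2 : ℝ) ≤ n := by exact_mod_cast hn2
    have hN : (0 : ℝ) < (n : ℝ) + m := by positivity
    have hK0 : 0 < K := by linarith
    have hkey : ((p : ℝ) - 1) * ((n : ℝ) + m) / ((n : ℝ) - 1) < K := by
      have h3 : (n : ℝ) * ((p : ℝ) - 1) / (((n : ℝ) - 1) * K) < n / ((n : ℝ) + m) := by
        have : (n : ℝ) / ((n : ℝ) + m) = 1 - (m : ℝ) / ((n : ℝ) + m) := by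
          field_simp; ring
        linarith
      have hn1 : 0 < (n : ℝ) - 1 := by linarith
      rw [div_lt_div_iff₀ (by positivity) hN] at h3
      rw [div_lt_iff₀ hn1]
      have h4 : (n : ℝ) * (((p : ℝ) - 1) * (n + m)) < n * (K * ((n : ℝ) - 1)) := by linarith
      exact lt_of_mul_lt_mul_left h4 (by linarith)
    obtain ⟨w, hw, hwK⟩ := exists_between (max_lt hK hkey)
    refine ⟨w, (le_max_left _ _).trans_lt hw, hwK, fun _ => ?_⟩
    have := (le_max_right _ _).trans_lt hw
    rw [div_lt_iff₀ (by linarith)] at this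
    linarith
  · obtain ⟨w, hw, hwK⟩ := exists_between hK
    exact ⟨w, hw, hwK, fun h => absurd h h2⟩

lemma exists_small {A A' B B' : ℝ} (hB : 0 < B) (hB' : 0 < B') :
    ∃ η > 0, η < 1 ∧ η * A ≤ B ∧ η * A' ≤ B' := by
  have key : ∀ {C D η : ℝ}, 0 < D → 0 < η → η ≤ D / (|C| + 1) → η * C ≤ D := by
    intro C D η hD hη h
    rw [le_div_iff₀ (by positivity)] at h
    nlinarith [le_abs_self C]
  set η := min (1 / 2) (min (B / (|A| + 1)) (B' / (|A'| + 1))) with hη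
  have hη0 : 0 < η := by positivity
  refine ⟨η, hη0, (min_le_left _ _).trans_lt (by norm_num), key hB hη0 ?_, key hB' hη0 ?_⟩
  · exact (min_le_right _ _).trans (min_le_left _ _)
  · exact (min_le_right _ _).trans (min_le_right _ _)

/-- Lemma 4.1.iv: if `ε_m = m/(n+m) < 1 - n(p-1)/((n-1)K)`, then `trace(V⁻¹)` is
bounded above uniformly over all `Y ∈ C_{2,r,m}(X)` and all M-estimates `V` for
`X ∪ Y`. -/
theorem statement13 (p n m : ℕ) (hp : 1 ≤ p) (hm : 1 ≤ m) (hn : p * (p - 1) < n)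
    (t : Fin p → ℝ) (u : ℝ → ℝ) (K : ℝ) (hu : Cond21 p u K)
    (X : Fin n → Fin p → ℝ) (hX : GenPosAbout t X)
    (r : ℝ) (hr : 0 < r)
    (heps : (m : ℝ) / ((n : ℝ) + m)
      < 1 - (n : ℝ) * ((p : ℝ) - 1) / (((n : ℝ) - 1) * K)) :
    ∃ C : ℝ, ∀ Y : Fin m → Fin p → ℝ, InC2 r t Y →
      ∀ V : Matrix (Fin p) (Fin p) ℝ,
        IsScatterMEstimate u t (Fin.append X Y) V → (V⁻¹).trace ≤ C := by
  have hpn : p ≤ n := by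
    rcases Nat.lt_or_ge p 2 with h | h
    · omega
    · have : p * 1 ≤ p * (p - 1) := Nat.mul_le_mul le_rfl (by omega)
      omega
  have hp0 : (1 : ℝ) ≤ p := by exact_mod_cast hp
  have hpn' : (p : ℝ) ≤ n := by exact_mod_cast hpn
  obtain ⟨w, hpw, hwK, hw⟩ := exists_threshold hn hu.K_gt_p heps
  obtain ⟨κ, hwκ, hκK⟩ := exists_between hwK
  obtain ⟨s₀, hs₀, hψ⟩ := hu.exists_forall_le hκK
  obtain ⟨δ, hδ, hcount⟩ := hX.exists_card_add_card_le hpn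
  set D := ∑ i, (X i - t) ⬝ᵥ (X i - t) with hD
  have hnn : ∀ d : Fin p → ℝ, 0 ≤ d ⬝ᵥ d := fun d =>
    Finset.sum_nonneg fun i _ => mul_self_nonneg _
  have hDi : ∀ i, (X i - t) ⬝ᵥ (X i - t) ≤ D := fun i =>
    Finset.single_le_sum (f := fun i => (X i - t) ⬝ᵥ (X i - t)) (fun i _ => hnn _)
      (Finset.mem_univ i)
  obtain ⟨η, hη0, hη1, hηs, hηD⟩ := exists_small (A := s₀) (A' := w * D)
    (lt_min hδ hr) (mul_pos (sub_pos.mpr hwκ) hδ)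
  refine ⟨p * (η ^ (p + 1))⁻¹, fun Y hY V hVM => ?_⟩
  by_contra! hcon
  obtain ⟨b, l, hl, hbd, hbV, hVinv, htr⟩ := hVM.1.exists_spectral
  have hsmall : ∃ a, l a ≤ η ^ (p + 1) := by
    by_contra! h
    have : ∑ a, (l a)⁻¹ ≤ ∑ _a : Fin p, (η ^ (p + 1))⁻¹ :=
      Finset.sum_le_sum fun a _ => inv_anti₀ (by positivity) (h a).le
    rw [htr] at hcon
    simp only [Finset.sum_const, Finset.card_univ, Fintype.card_fin, nsmul_eq_mul] at this
    linarith
  obtain ⟨τ, hτ0, hτη, ⟨a₀, ha₀⟩, hgap⟩ := exists_gap l hη0 hη1 hsmall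
  set A : Finset (Fin p) := {a | l a ≤ η * τ} with hA
  have hA1 : A.Nonempty := ⟨a₀, by simpa [hA] using ha₀⟩
  have hA1' : 1 ≤ #A := hA1.card_pos
  set z := Fin.append X Y with hz
  set s : Fin (n + m) → ℝ := fun i => (z i - t) ⬝ᵥ (V⁻¹ *ᵥ (z i - t)) with hs
  set x : Fin (n + m) → ℝ := fun i => ∑ a ∈ A, (b a ⬝ᵥ (z i - t)) ^ 2 / l a with hx
  set y : Fin (n + m) → ℝ := fun i => ∑ a ∈ Aᶜ, (b a ⬝ᵥ (z i - t)) ^ 2 / l a with hy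
  have hsxy : ∀ i, s i = x i + y i := fun i => by
    simp only [hs, hx, hy, hVinv, Finset.sum_add_sum_compl]
  have hx0 : ∀ i, 0 ≤ x i := fun i =>
    Finset.sum_nonneg fun a _ => div_nonneg (sq_nonneg _) (hl a).le
  have hy0 : ∀ i, 0 ≤ y i := fun i =>
    Finset.sum_nonneg fun a _ => div_nonneg (sq_nonneg _) (hl a).le
  have hηs' : η * s₀ ≤ δ := hηs.trans (min_le_left _ _)
  have hηr : η * s₀ ≤ r := hηs.trans (min_le_right _ _)
  have hxlow : ∀ i, (∑ a ∈ A, (b a ⬝ᵥ (z i - t)) ^ 2) ≤ x i * (η * τ) := fun i => by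
    rw [hx, Finset.sum_mul]
    refine Finset.sum_le_sum fun a ha => ?_
    rw [div_mul_eq_mul_div, le_div_iff₀ (hl a)]
    have : l a ≤ η * τ := by simpa [hA] using ha
    gcongr
  have hyup : ∀ i, y i * τ ≤ (z i - t) ⬝ᵥ (z i - t) := fun i => by
    rw [hbd, hy, Finset.sum_mul]
    refine (Finset.sum_le_sum fun a ha => ?_).trans
      (Finset.sum_le_univ_sum_of_nonneg (s := Aᶜ) fun a => sq_nonneg _)
    have h1 : ¬ l a ≤ η * τ := by simpa [hA] using ha
    have h2 : τ < l a := (hgap a).resolve_left h1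
    rw [div_mul_eq_mul_div, div_le_iff₀ (hl a)]
    gcongr
  have hxs : ∀ i c, η * s₀ ≤ c → c ≤ x i * (η * τ) → s₀ ≤ s i := by
    intro i c h1 h2
    have h3 : s₀ * η ≤ (x i * τ) * η := by linarith
    have h4 : s₀ ≤ x i * τ := le_of_mul_le_mul_right h3 hη0
    have h5 : x i * τ ≤ x i * 1 := by
      gcongr
      · exact hx0 i
      · linarith
    linarith [hsxy i, hy0 i]
  have hkey : (((n + m : ℕ) : ℝ)) * #A = ∑ i, u (s i) * x i := by
    have hN : ((n + m : ℕ) : ℝ) ≠ 0 := by positivity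
    have h1 : ∀ a, ((n + m : ℕ) : ℝ) = ∑ i, u (s i) * ((b a ⬝ᵥ (z i - t)) ^ 2 / l a) := by
      intro a
      have h2 := hVM.dotProduct_mulVec (b a)
      rw [hbV] at h2
      have h3 : ((n + m : ℕ) : ℝ) * l a = ∑ i, u (s i) * (b a ⬝ᵥ (z i - t)) ^ 2 := by
        rw [h2, ← mul_assoc, mul_inv_cancel₀ hN, one_mul]
      simp only [← mul_div_assoc]
      rw [← Finset.sum_div, ← h3, mul_div_cancel_right₀ _ (hl a).ne']
    calc ((n + m : ℕ) : ℝ) * #A = ∑ _a ∈ A, ((n + m : ℕ) : ℝ) := by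
          rw [Finset.sum_const, nsmul_eq_mul, mul_comm]
      _ = ∑ a ∈ A, ∑ i, u (s i) * ((b a ⬝ᵥ (z i - t)) ^ 2 / l a) :=
          Finset.sum_congr rfl fun a _ => h1 a
      _ = _ := by
          rw [Finset.sum_comm]
          simp only [hx, Finset.mul_sum]
  have hterm0 : ∀ i, 0 ≤ u (s i) * x i := by
    intro i
    rcases (hx0 i).eq_or_lt with h | h
    · rw [← h, mul_zero]
    · exact mul_nonneg (hu.nonneg (by linarith [hsxy i, hy0 i])) h.le
  have hgood : ∀ i, s₀ ≤ s i → w * y i ≤ (κ - w) * x i → w ≤ u (s i) * x i := by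
    intro i h1 h2
    have h3 := hψ _ h1
    have hu0 := hu.nonneg (hs₀.trans_le h1)
    have h4 : w * s i ≤ κ * x i := by rw [hsxy]; linarith
    have hκ0 : 0 < κ := by linarith
    refine le_of_mul_le_mul_left ?_ hκ0
    calc κ * w ≤ (s i * u (s i)) * w := by gcongr; linarith
      _ = u (s i) * (w * s i) := by ring
      _ ≤ u (s i) * (κ * x i) := by gcongr
      _ = κ * (u (s i) * x i) := by ring
  have hzX : ∀ i, z (Fin.castAdd m i) = X i := fun i => Fin.append_left X Y i
  have hzY : ∀ i, z (Fin.natAdd n i) = Y i := fun i => Fin.append_right X Y i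
  have hXgood : ∀ i, δ ≤ ∑ a ∈ A, (b a ⬝ᵥ (X i - t)) ^ 2 →
      w ≤ u (s (Fin.castAdd m i)) * x (Fin.castAdd m i) := by
    intro i hi
    have h1 := hxlow (Fin.castAdd m i)
    have h2 := hyup (Fin.castAdd m i)
    rw [hzX] at h1 h2
    have h3 := hi.trans h1
    refine hgood _ (hxs _ _ hηs' h3) ?_
    have hw0 : 0 < w := by linarith
    refine le_of_mul_le_mul_right ?_ (mul_pos hη0 hτ0)
    calc w * y _ * (η * τ) = η * (w * (y (Fin.castAdd m i) * τ)) := by ring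
      _ ≤ η * (w * D) := by gcongr; exact h2.trans (hDi i)
      _ ≤ (κ - w) * δ := hηD
      _ ≤ (κ - w) * (x _ * (η * τ)) := mul_le_mul_of_nonneg_left h3 (by linarith)
      _ = _ := by ring
  have hbad := hcount b hbd A hA1
  rw [Fin.sum_univ_add] at hkey
  set bad : Finset (Fin n) := {i | ∑ a ∈ A, (b a ⬝ᵥ (X i - t)) ^ 2 < δ} with hbaddef
  have hXsum : ((n : ℝ) - #bad) * w
      ≤ ∑ i, u (s (Fin.castAdd m i)) * x (Fin.castAdd m i) := by
    have h1 : ((#badᶜ : ℕ) : ℝ) = (n : ℝ) - #bad := by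
      have := Finset.card_add_card_compl bad
      rw [Fintype.card_fin] at this
      rw [eq_sub_iff_add_eq']
      exact_mod_cast this
    rw [← h1, ← nsmul_eq_mul]
    refine (Finset.card_nsmul_le_sum _ (fun i => u (s (Fin.castAdd m i)) * x (Fin.castAdd m i)) _
      fun i hi => hXgood i ?_).trans (Finset.sum_le_univ_sum_of_nonneg fun i => hterm0 _)
    simpa [hbaddef] using hi
  have hbadR : (#bad : ℝ) + #A ≤ p := by exact_mod_cast hbad
  have hw0 : 0 < w := by linarith
  push_cast at hkey
  by_cases hfull : A = Finset.univ
  · have hcardA : (#A : ℝ) = p := by simp [hfull]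
    have hYsum : (m : ℝ) * w ≤ ∑ i, u (s (Fin.natAdd n i)) * x (Fin.natAdd n i) := by
      have : ∀ i ∈ Finset.univ, w ≤ u (s (Fin.natAdd n i)) * x (Fin.natAdd n i) := by
        intro i _
        have h1 := hxlow (Fin.natAdd n i)
        rw [hzY, hfull, ← hbd] at h1
        refine hgood _ (hxs _ _ hηr ((hY i).le.trans h1)) ?_
        have h2 : y (Fin.natAdd n i) = 0 := by simp [hy, hfull]
        rw [h2, mul_zero]
        exact mul_nonneg (by linarith) (hx0 _)
      simpa using Finset.card_nsmul_le_sum _ _ _ this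
    have hb0 : (#bad : ℝ) = 0 := le_antisymm (by linarith) (Nat.cast_nonneg _)
    rw [hb0] at hXsum
    rw [hcardA] at hkey
    have : ((n : ℝ) + m) * p < (n + m) * w := by gcongr
    linarith
  · have hlt : #A + 1 ≤ p := by
      have := Finset.card_lt_card (Finset.ssubset_univ_iff.mpr hfull)
      simpa using this
    have hp2 := hw (by omega)
    have hltR : (#A : ℝ) + 1 ≤ p := by exact_mod_cast hlt
    have hA1R : (1 : ℝ) ≤ #A := by exact_mod_cast hA1'
    have hYsum : 0 ≤ ∑ i, u (s (Fin.natAdd n i)) * x (Fin.natAdd n i) :=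
      Finset.sum_nonneg fun i _ => hterm0 _
    have h1 : ((n : ℝ) - p + #A) * w ≤ ((n : ℝ) + m) * #A :=
      calc ((n : ℝ) - p + #A) * w ≤ ((n : ℝ) - #bad) * w := by gcongr; linarith
        _ ≤ _ := by linarith
    have h2 : (((n : ℝ) - p + #A) * w) * (p - 1) ≤ (((n : ℝ) + m) * #A) * (p - 1) := by
      gcongr
    have h3 : (#A : ℝ) * (((p : ℝ) - 1) * (n + m)) < #A * (((n : ℝ) - 1) * w) := by gcongr
    have h4 : 0 ≤ ((n : ℝ) - p) * (p - 1 - #A) * w :=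
      mul_nonneg (mul_nonneg (by linarith) (by linarith)) hw0.le
    nlinarith
end
end

section
/- Suppose u satisfies Condition 2.1 with constant K, n + 1 > K, ρ > 0 and r > 0. Then there exists a constant C < ∞, depending only on X, u, m, ρ and r, such that for every Y ∈ C_{1,ρ,m}(X) ∩ C_{2,r,m}(X) and every M-estimate of scatter V for Z = X ∪ Y about t, trace(V⁻¹) ≤ C. -/
open Matrix Finset Filter

noncomputable section

lemma dotProduct_vecMulVec_self_mulVec {p : ℕ} (a v : Fin p → ℝ) :
    v ⬝ᵥ (Matrix.vecMulVec a a *ᵥ v) = (a ⬝ᵥ v) ^ 2 := by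
  rw [Matrix.vecMulVec_mulVec, dotProduct_smul, dotProduct_comm v a]
  simp [sq]

lemma dotProduct_self_pos_of_ne_zero {p : ℕ} {v : Fin p → ℝ} (hv : v ≠ 0) : 0 < v ⬝ᵥ v := by
  obtain ⟨i, hi⟩ := Function.ne_iff.mp hv
  exact Finset.sum_pos' (fun j _ => mul_self_nonneg _) ⟨i, mem_univ _, mul_self_pos.mpr hi⟩

/-- Spectral decomposition of a positive definite matrix in terms of dot products. -/
lemma exists_eigenbasis_of_posDef {p : ℕ} {V : Matrix (Fin p) (Fin p) ℝ} (hV : V.PosDef) :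
    ∃ (b : Fin p → Fin p → ℝ) (l : Fin p → ℝ), (∀ i, 0 < l i) ∧ (∀ i, b i ⬝ᵥ b i = 1) ∧
      (∀ x, ∑ i, (b i ⬝ᵥ x) ^ 2 = x ⬝ᵥ x) ∧ (∀ i, V *ᵥ b i = l i • b i) ∧
      ∀ x, x ⬝ᵥ (V⁻¹ *ᵥ x) = ∑ i, (b i ⬝ᵥ x) ^ 2 / l i := by
  set B := hV.isHermitian.eigenvectorBasis with hB
  have hin : ∀ x y : EuclideanSpace ℝ (Fin p), inner ℝ x y = x.ofLp ⬝ᵥ y.ofLp := fun x y => by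
    rw [EuclideanSpace.inner_eq_star_dotProduct, dotProduct_comm]; simp
  have hpars : ∀ x y : Fin p → ℝ,
      ∑ i, ((B i).ofLp ⬝ᵥ x) * ((B i).ofLp ⬝ᵥ y) = x ⬝ᵥ y := by
    intro x y
    have := B.sum_inner_mul_inner (WithLp.toLp 2 x) (WithLp.toLp 2 y)
    simp only [hin] at this
    rw [← this]
    exact Finset.sum_congr rfl fun i _ => by rw [dotProduct_comm x]
  have hVb : ∀ i, V *ᵥ (B i).ofLp = hV.isHermitian.eigenvalues i • (B i).ofLp := fun i =>
    hV.isHermitian.mulVec_eigenvectorBasis i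
  have hu : IsUnit V.det := hV.det_pos.ne'.isUnit
  have hl : ∀ i, 0 < hV.isHermitian.eigenvalues i := hV.eigenvalues_pos
  refine ⟨fun i => (B i).ofLp, hV.isHermitian.eigenvalues, hl, ?_, ?_, hVb, ?_⟩
  · intro i
    rw [← hin, real_inner_self_eq_norm_sq, B.norm_eq_one]; norm_num
  · intro x
    rw [← hpars x x]
    exact Finset.sum_congr rfl fun i _ => sq _
  · intro x
    rw [← hpars x]
    refine Finset.sum_congr rfl fun i _ => ?_
    have hT : V⁻¹ᵀ = V⁻¹ := by
      have := hV.inv.isHermitian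
      rwa [Matrix.IsHermitian, Matrix.conjTranspose_eq_transpose_of_trivial] at this
    have h1 : V⁻¹ *ᵥ (B i).ofLp = (hV.isHermitian.eigenvalues i)⁻¹ • (B i).ofLp := by
      have h2 : (B i).ofLp = V⁻¹ *ᵥ (V *ᵥ (B i).ofLp) := by
        rw [Matrix.mulVec_mulVec, Matrix.nonsing_inv_mul _ hu, Matrix.one_mulVec]
      rw [hVb, Matrix.mulVec_smul] at h2
      rw [eq_inv_smul_iff₀ (hl i).ne']
      exact h2.symm
    have h3 : (B i).ofLp ⬝ᵥ (V⁻¹ *ᵥ x) =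
        (hV.isHermitian.eigenvalues i)⁻¹ * ((B i).ofLp ⬝ᵥ x) := by
      rw [Matrix.dotProduct_mulVec, ← Matrix.mulVec_transpose, hT, h1, smul_dotProduct,
        smul_eq_mul]
    rw [h3]
    field_simp

/-- A lower bound for the least eigenvalue of `ΘᵀΘ` is one for the least eigenvalue
of `ΘΘᵀ`, where `Θ` is the square matrix with rows `θ j`. -/
lemma gram_lower_bound {p : ℕ} {ρ : ℝ} (hρ : 0 < ρ) {θ : Fin p → Fin p → ℝ}
    (hθ : ∀ v : Fin p → ℝ, ρ * (v ⬝ᵥ v) ≤ ∑ j, (θ j ⬝ᵥ v) ^ 2) (w : Fin p → ℝ) :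
    ρ * (w ⬝ᵥ w) ≤ (w ᵥ* Matrix.of θ) ⬝ᵥ (w ᵥ* Matrix.of θ) := by
  set T : Matrix (Fin p) (Fin p) ℝ := Matrix.of θ
  have hT : ∀ v, ρ * (v ⬝ᵥ v) ≤ (T *ᵥ v) ⬝ᵥ (T *ᵥ v) := fun v =>
    (hθ v).trans_eq (Finset.sum_congr rfl fun j _ => sq _)
  have hinj : Function.Injective T.mulVecLin := by
    rw [← LinearMap.ker_eq_bot, LinearMap.ker_eq_bot']
    intro v hv
    by_contra h
    have h1 := hT v
    rw [Matrix.mulVecLin_apply] at hv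
    rw [hv, zero_dotProduct] at h1
    have := mul_pos hρ (dotProduct_self_pos_of_ne_zero h)
    linarith
  obtain ⟨v, hv⟩ := LinearMap.injective_iff_surjective.mp hinj w
  rw [Matrix.mulVecLin_apply] at hv
  rcases eq_or_ne w 0 with rfl | hw
  · simp
  have hwp := dotProduct_self_pos_of_ne_zero hw
  have h1 : w ⬝ᵥ w = (w ᵥ* T) ⬝ᵥ v := by
    conv_lhs => rw [← hv]
    rw [Matrix.dotProduct_mulVec, hv]
  have h2 : ((w ᵥ* T) ⬝ᵥ v) ^ 2 ≤ ((w ᵥ* T) ⬝ᵥ (w ᵥ* T)) * (v ⬝ᵥ v) := by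
    have := Finset.sum_mul_sq_le_sq_mul_sq univ (w ᵥ* T) v
    simpa only [dotProduct, ← sq] using this
  have h3 := hT v
  rw [hv] at h3
  rw [← h1] at h2
  have h4 : 0 ≤ (w ᵥ* T) ⬝ᵥ (w ᵥ* T) := Finset.sum_nonneg fun j _ => mul_self_nonneg _
  have h5 := mul_le_mul_of_nonneg_left h3 h4
  have h6 := mul_le_mul_of_nonneg_left h2 hρ.le
  refine le_of_mul_le_mul_right ?_ hwp
  nlinarith

/-- If the directions `θ j` are quantitatively independent, at most `p - #A` of them
are nearly orthogonal to the span of the `b i`, `i ∈ A`. -/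
lemma card_near_orthogonal_add_card_le {p : ℕ} {ρ : ℝ} (hρ : 0 < ρ) {θ b : Fin p → Fin p → ℝ}
    (hθ : ∀ v : Fin p → ℝ, ρ * (v ⬝ᵥ v) ≤ ∑ j, (θ j ⬝ᵥ v) ^ 2)
    (hb : ∀ x, ∑ i, (b i ⬝ᵥ x) ^ 2 = x ⬝ᵥ x) (A G : Finset (Fin p))
    (hG : ∀ j ∈ G, ∑ i ∈ A, (b i ⬝ᵥ θ j) ^ 2 < ρ / p) : #G + #A ≤ p := by
  by_contra! hcard
  let L : (Fin p → ℝ) →ₗ[ℝ] ({j // j ∉ G} → ℝ) × ({i // i ∉ A} → ℝ) :=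
    { toFun := fun w => (fun j => w j, fun i => b i ⬝ᵥ (w ᵥ* Matrix.of θ))
      map_add' := fun w w' => by
        ext <;> simp [Matrix.add_vecMul, dotProduct_add]
      map_smul' := fun a w => by
        ext <;> simp [Matrix.smul_vecMul, dotProduct_smul] }
  have hA := Finset.card_le_univ A
  have hGu := Finset.card_le_univ G
  rw [Fintype.card_fin] at hA hGu
  have hker : LinearMap.ker L ≠ ⊥ := by
    apply LinearMap.ker_ne_bot_of_finrank_lt
    simp only [Module.finrank_prod, Module.finrank_fintype_fun_eq_card, Fintype.card_fin]
    rw [Fintype.card_subtype_compl, Fintype.card_subtype_compl]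
    simp only [Fintype.card_fin, Fintype.card_coe]
    omega
  obtain ⟨w, hw, hw0⟩ := (Submodule.ne_bot_iff _).mp hker
  rw [LinearMap.mem_ker] at hw
  have hw1 : ∀ j ∉ G, w j = 0 := fun j hj => congrFun (congrArg Prod.fst hw) ⟨j, hj⟩
  have hw2 : ∀ i ∉ A, b i ⬝ᵥ (w ᵥ* Matrix.of θ) = 0 := fun i hi =>
    congrFun (congrArg Prod.snd hw) ⟨i, hi⟩
  have hwp := dotProduct_self_pos_of_ne_zero hw0
  have hlow := gram_lower_bound hρ hθ w
  rw [← hb (w ᵥ* Matrix.of θ),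
    ← Finset.sum_subset (Finset.subset_univ A) fun i _ hi => by rw [hw2 i hi]; simp]
    at hlow
  have hexp : ∀ i, b i ⬝ᵥ (w ᵥ* Matrix.of θ) = ∑ j ∈ G, w j * (b i ⬝ᵥ θ j) := by
    intro i
    rw [dotProduct_comm, ← Matrix.dotProduct_mulVec, dotProduct,
      ← Finset.sum_subset (Finset.subset_univ G) fun j _ hj => by rw [hw1 j hj, zero_mul]]
    exact Finset.sum_congr rfl fun j _ => by rw [dotProduct_comm (b i)]; rfl
  have hww : ∑ j ∈ G, w j ^ 2 = w ⬝ᵥ w := by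
    rw [dotProduct,
      ← Finset.sum_subset (Finset.subset_univ G) fun j _ hj => by rw [hw1 j hj, zero_mul]]
    exact Finset.sum_congr rfl fun j _ => sq _
  have hcs : ∑ i ∈ A, (b i ⬝ᵥ (w ᵥ* Matrix.of θ)) ^ 2 ≤
      (w ⬝ᵥ w) * ∑ j ∈ G, ∑ i ∈ A, (b i ⬝ᵥ θ j) ^ 2 := by
    rw [Finset.sum_comm, Finset.mul_sum]
    refine Finset.sum_le_sum fun i _ => ?_
    rw [hexp, ← hww]
    exact Finset.sum_mul_sq_le_sq_mul_sq G w _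
  have hGne : G.Nonempty := Finset.card_pos.mp (by omega)
  have hp0 : (0 : ℝ) < p := by
    have : 0 < p := lt_of_lt_of_le (Finset.card_pos.mpr hGne) hGu
    exact_mod_cast this
  have hsum : ∑ j ∈ G, ∑ i ∈ A, (b i ⬝ᵥ θ j) ^ 2 < ρ := by
    calc _ < ∑ _j ∈ G, ρ / p := Finset.sum_lt_sum_of_nonempty hGne hG
      _ = #G * (ρ / p) := by rw [Finset.sum_const, nsmul_eq_mul]
      _ ≤ p * (ρ / p) := by gcongr
      _ = ρ := by field_simp
  have := mul_lt_mul_of_pos_left hsum hwp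
  linarith

/-- Among at least one and at most `p` numbers that are not all above `η γ ^ p`, there is a
multiplicative gap of size `γ`. -/
lemma exists_gap_s14 {p : ℕ} {η γ : ℝ} (hη : 0 < η) (hγ : 0 < γ) (hγ1 : γ ≤ 1) (l : Fin p → ℝ)
    {i₀ : Fin p} (hi₀ : l i₀ ≤ η * γ ^ p) :
    ∃ k, i₀ ∈ univ.filter (fun i => l i ≤ η * γ ^ (k + 1)) ∧
      ∀ i, η * γ ^ (k + 1) < l i → η * γ ^ k < l i := by
  by_contra! h
  have hanti : ∀ k k' : ℕ, k ≤ k' → η * γ ^ k' ≤ η * γ ^ k := fun k k' hk =>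
    mul_le_mul_of_nonneg_left (pow_le_pow_of_le_one hγ.le hγ1 hk) hη.le
  have key : ∀ k ≤ p, #(univ.filter fun i => l i ≤ η * γ ^ k) + k ≤ p := by
    intro k
    induction k with
    | zero => exact fun _ => by simpa using Finset.card_le_univ (univ.filter fun i => l i ≤ η)
    | succ k ih =>
      intro hk
      obtain ⟨i, hi1, hi2⟩ := h k (by
        simp only [mem_filter, mem_univ, true_and]
        exact hi₀.trans (hanti _ _ hk))
      have : #(univ.filter fun i => l i ≤ η * γ ^ (k + 1)) <
          #(univ.filter fun i => l i ≤ η * γ ^ k) := by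
        apply Finset.card_lt_card
        refine ⟨fun j hj => ?_, fun hsub => ?_⟩
        · simp only [mem_filter, mem_univ, true_and] at hj ⊢
          exact hj.trans (hanti _ _ k.le_succ)
        · have := hsub (show i ∈ _ by simpa using hi2)
          simp only [mem_filter, mem_univ, true_and] at this
          linarith
      have := ih (by omega)
      omega
  have h1 := key p le_rfl
  have h2 : 0 < #(univ.filter fun i => l i ≤ η * γ ^ p) :=
    Finset.card_pos.mpr ⟨i₀, by simpa using hi₀⟩
  omega

lemma InC1.rayleigh_le {p n m : ℕ} {ρ : ℝ} {t : Fin p → ℝ} {X : Fin n → Fin p → ℝ}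
    {Y : Fin m → Fin p → ℝ} (h : InC1 ρ t X Y) {f : Fin p → Fin (n + m)}
    (hf : Function.Injective f) (hne : ∀ j, Fin.append X Y (f j) ≠ t) (v : Fin p → ℝ) :
    ρ * (v ⬝ᵥ v) ≤ ∑ j, (dirFrom t (Fin.append X Y (f j)) ⬝ᵥ v) ^ 2 := by
  rcases eq_or_ne v 0 with rfl | hv
  · simp
  have hvp := dotProduct_self_pos_of_ne_zero hv
  have hs : (Real.sqrt (v ⬝ᵥ v))⁻¹ * (Real.sqrt (v ⬝ᵥ v))⁻¹ = (v ⬝ᵥ v)⁻¹ := by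
    rw [← mul_inv, Real.mul_self_sqrt hvp.le]
  have h1 := h f hf hne ((Real.sqrt (v ⬝ᵥ v))⁻¹ • v) (by
    rw [smul_dotProduct, dotProduct_smul, smul_eq_mul, smul_eq_mul, ← mul_assoc, hs,
      inv_mul_cancel₀ hvp.ne'])
  rw [Matrix.sum_mulVec, dotProduct_sum] at h1
  simp only [dotProduct_vecMulVec_self_mulVec, dotProduct_smul, smul_eq_mul, mul_pow] at h1
  rw [← Finset.mul_sum, sq, hs, ← div_eq_inv_mul, lt_div_iff₀ hvp] at h1
  exact h1.le

lemma dotProduct_dirFrom_sq {p : ℕ} (t z b : Fin p → ℝ) :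
    (b ⬝ᵥ dirFrom t z) ^ 2 = (b ⬝ᵥ (z - t)) ^ 2 / sqDist t z := by
  rw [dirFrom, dotProduct_smul, smul_eq_mul, mul_pow, inv_pow, Real.sq_sqrt, div_eq_inv_mul]
  change 0 ≤ ∑ i, (z - t) i * (z - t) i
  exact Finset.sum_nonneg fun j _ => mul_self_nonneg ((z - t) j)

/-- For configurations in `C₁`, at most `p - #A` points are, in direction, nearly orthogonal
to the span of the `b i`, `i ∈ A`. -/
lemma InC1.card_near_orthogonal_add_card_le {p n m : ℕ} {ρ : ℝ} (hρ : 0 < ρ) {t : Fin p → ℝ}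
    {X : Fin n → Fin p → ℝ} {Y : Fin m → Fin p → ℝ} (h : InC1 ρ t X Y) (hpn : p ≤ n + m)
    (hne : ∀ j, Fin.append X Y j ≠ t) {b : Fin p → Fin p → ℝ}
    (hb : ∀ x, ∑ i, (b i ⬝ᵥ x) ^ 2 = x ⬝ᵥ x) {A : Finset (Fin p)} (hA : A.Nonempty) :
    #(univ.filter fun j => ∑ i ∈ A, (b i ⬝ᵥ (Fin.append X Y j - t)) ^ 2 <
      ρ / p * sqDist t (Fin.append X Y j)) + #A ≤ p := by
  set B := univ.filter fun j => ∑ i ∈ A, (b i ⬝ᵥ (Fin.append X Y j - t)) ^ 2 <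
      ρ / p * sqDist t (Fin.append X Y j) with hB
  by_contra! hcard
  have hAp := Finset.card_pos.mpr hA
  have hAu := Finset.card_le_univ A
  rw [Fintype.card_fin] at hAu
  obtain ⟨B', hB', hB'c⟩ := Finset.exists_subset_card_eq (s := B) (n := p - #A + 1) (by omega)
  obtain ⟨D, hD, -, hDc⟩ := Finset.exists_subsuperset_card_eq (Finset.subset_univ B')
    (n := p) (by omega) (by simpa using hpn)
  set f := D.orderEmbOfFin hDc
  have hle := _root_.card_near_orthogonal_add_card_le hρ
    (h.rayleigh_le f.injective fun j => hne _) hb A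
    (univ.filter fun j => f j ∈ B') (fun j hj => by
      have hj' : f j ∈ B := hB' (by simpa using hj)
      rw [hB, mem_filter] at hj'
      have hpos : 0 < sqDist t (Fin.append X Y (f j)) :=
        dotProduct_self_pos_of_ne_zero (sub_ne_zero.mpr (hne _))
      simp only [dotProduct_dirFrom_sq]
      rw [← Finset.sum_div, div_lt_iff₀ hpos]
      exact hj'.2)
  have hc : #B' ≤ #(univ.filter fun j => f j ∈ B') := by
    have hsub : B' ⊆ (univ.filter fun j => f j ∈ B').image f := by
      intro x hx
      have hx' : x ∈ Set.range f := by
        rw [Finset.range_orderEmbOfFin]; exact hD hx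
      obtain ⟨j, rfl⟩ := hx'
      exact Finset.mem_image_of_mem _ (by simpa using hx)
    exact (Finset.card_le_card hsub).trans Finset.card_image_le
  omega

lemma GenPosAbout.ne_center {p n : ℕ} (hp : 1 ≤ p) (hpn : p ≤ n) {t : Fin p → ℝ}
    {X : Fin n → Fin p → ℝ} (hX : GenPosAbout t X) (i : Fin n) : X i ≠ t := by
  let g : Fin p → Fin n := fun j => Equiv.swap (Fin.castLE hpn ⟨0, hp⟩) i (Fin.castLE hpn j)
  have hg : Function.Injective g :=
    (Equiv.injective _).comp (Fin.castLE_injective hpn)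
  have h := (hX g hg).ne_zero ⟨0, hp⟩
  simp only [g, Equiv.swap_apply_left] at h
  exact sub_ne_zero.mp h

lemma le_weight_mul_of_gap {p : ℕ} {u : ℝ → ℝ} {K s₀ M g e τ τ' a d : ℝ} (hu : Cond21 p u K)
    (hs₀ : 0 < s₀) (hg : 0 ≤ g) (hψ : (1 + g) * M ≤ s₀ * u s₀)
    {b : Fin p → ℝ} {l : Fin p → ℝ} (hl : ∀ i, 0 < l i) {A : Finset (Fin p)}
    (hτ : 0 < τ) (hτ' : 0 < τ') (hd : ∑ i, b i ^ 2 = d)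
    (hA : ∀ i ∈ A, l i ≤ τ) (hAc : ∀ i ∉ A, τ' ≤ l i) (he : e * d ≤ ∑ i ∈ A, b i ^ 2)
    (hgap : τ ≤ g * e * τ') (hd0 : 0 ≤ d) (ha : a = ∑ i ∈ A, b i ^ 2 / l i)
    (hs : s₀ * τ ≤ e * d) :
    M ≤ u (∑ i, b i ^ 2 / l i) * a := by
  have h1 : e * d / τ ≤ a := by
    calc e * d / τ ≤ (∑ i ∈ A, b i ^ 2) / τ := by gcongr
      _ = ∑ i ∈ A, b i ^ 2 / τ := Finset.sum_div _ _ _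
      _ ≤ a := by
        rw [ha]
        exact Finset.sum_le_sum fun i hi =>
          div_le_div_of_nonneg_left (sq_nonneg _) (hl i) (hA i hi)
  have h2 : ∑ i ∈ Aᶜ, b i ^ 2 / l i ≤ d / τ' := by
    calc ∑ i ∈ Aᶜ, b i ^ 2 / l i ≤ ∑ i ∈ Aᶜ, b i ^ 2 / τ' :=
          Finset.sum_le_sum fun i hi =>
            div_le_div_of_nonneg_left (sq_nonneg _) hτ' (hAc i (Finset.mem_compl.mp hi))
      _ = (∑ i ∈ Aᶜ, b i ^ 2) / τ' := (Finset.sum_div _ _ _).symm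
      _ ≤ d / τ' := by
        gcongr
        rw [← hd]
        exact Finset.sum_le_univ_sum_of_nonneg fun i => sq_nonneg _
  have h3 : d / τ' ≤ g * (e * d / τ) := by
    rw [← mul_div_assoc, div_le_div_iff₀ hτ' hτ]
    nlinarith
  have h4 : s₀ ≤ e * d / τ := (le_div_iff₀ hτ).mpr hs
  set s := ∑ i, b i ^ 2 / l i with hsdef
  have hsplit : s = a + ∑ i ∈ Aᶜ, b i ^ 2 / l i := by
    rw [ha, hsdef, Finset.sum_add_sum_compl]
  have hcn : 0 ≤ ∑ i ∈ Aᶜ, b i ^ 2 / l i :=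
    Finset.sum_nonneg fun i _ => div_nonneg (sq_nonneg _) (hl i).le
  have hs0 : s₀ ≤ s := by linarith
  have hsa : s ≤ (1 + g) * a := by
    have := mul_le_mul_of_nonneg_left h1 hg
    linarith
  have hψs := hu.psi_mono hs₀ hs0
  have hun := hu.nonneg (hs₀.trans_le hs0)
  have := mul_le_mul_of_nonneg_right hsa hun
  refine le_of_mul_le_mul_left ?_ (show 0 < 1 + g by linarith)
  linarith

/-- The trace identity for an M-estimate restricted to a set of eigendirections. -/
lemma IsScatterMEstimate.sum_eigendirections {p N : ℕ} (hN : 0 < N) {u : ℝ → ℝ}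
    {t : Fin p → ℝ} {z : Fin N → Fin p → ℝ} {V : Matrix (Fin p) (Fin p) ℝ}
    (h : IsScatterMEstimate u t z V) (hne : ∀ j, z j ≠ t) {b : Fin p → Fin p → ℝ}
    {l : Fin p → ℝ} (hl : ∀ i, 0 < l i) (hb : ∀ i, b i ⬝ᵥ b i = 1)
    (hVb : ∀ i, V *ᵥ b i = l i • b i) (A : Finset (Fin p)) :
    (N : ℝ) * #A = ∑ j, u ((z j - t) ⬝ᵥ (V⁻¹ *ᵥ (z j - t))) *
      ∑ i ∈ A, (b i ⬝ᵥ (z j - t)) ^ 2 / l i := by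
  have hN' : (0 : ℝ) < N := by exact_mod_cast hN
  have key : ∀ i, (N : ℝ) * l i =
      ∑ j, u ((z j - t) ⬝ᵥ (V⁻¹ *ᵥ (z j - t))) * (b i ⬝ᵥ (z j - t)) ^ 2 := by
    intro i
    have h1 : b i ⬝ᵥ (V *ᵥ b i) = l i := by
      rw [hVb, dotProduct_smul, hb, smul_eq_mul, mul_one]
    have h2 : b i ⬝ᵥ (V *ᵥ b i) = (N : ℝ)⁻¹ *
        ∑ j, u ((z j - t) ⬝ᵥ (V⁻¹ *ᵥ (z j - t))) * (b i ⬝ᵥ (z j - t)) ^ 2 := by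
      conv_lhs => rw [h.2]
      simp only [hne, if_false]
      rw [Matrix.smul_mulVec, Matrix.sum_mulVec, dotProduct_smul, dotProduct_sum, smul_eq_mul]
      congr 1
      refine Finset.sum_congr rfl fun j _ => ?_
      rw [Matrix.smul_mulVec, dotProduct_smul, dotProduct_vecMulVec_self_mulVec, smul_eq_mul,
        dotProduct_comm (b i)]
    rw [← h1, h2, mul_inv_cancel_left₀ hN'.ne']
  simp only [Finset.mul_sum]
  rw [Finset.sum_comm]
  have : ∀ i ∈ A, ∑ j, u ((z j - t) ⬝ᵥ (V⁻¹ *ᵥ (z j - t))) *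
      ((b i ⬝ᵥ (z j - t)) ^ 2 / l i) = N := by
    intro i _
    simp only [← mul_div_assoc]
    rw [← Finset.sum_div, ← key, mul_div_cancel_right₀ _ (hl i).ne']
  rw [Finset.sum_congr rfl this, Finset.sum_const, nsmul_eq_mul, mul_comm]

/-- Lemma 4.1.v: if `n + 1 > K`, then for any `m`, `trace(V⁻¹)` is bounded above
uniformly over all `Y ∈ C_{1,ρ,m}(X) ∩ C_{2,r,m}(X)` and all M-estimates `V` for
`X ∪ Y`. -/
theorem statement14 (p n m : ℕ) (hp : 1 ≤ p) (hm : 1 ≤ m) (hn : p * (p - 1) < n)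
    (t : Fin p → ℝ) (u : ℝ → ℝ) (K : ℝ) (hu : Cond21 p u K)
    (X : Fin n → Fin p → ℝ) (hX : GenPosAbout t X)
    (hnK : K < (n : ℝ) + 1) (ρ r : ℝ) (hρ : 0 < ρ) (hr : 0 < r) :
    ∃ C : ℝ, ∀ Y : Fin m → Fin p → ℝ, InC1 ρ t X Y → InC2 r t Y →
      ∀ V : Matrix (Fin p) (Fin p) ℝ,
        IsScatterMEstimate u t (Fin.append X Y) V → (V⁻¹).trace ≤ C := by
  have hpn : p ≤ n := by
    rcases Nat.lt_or_ge 1 p with h | h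
    · have : p * 1 ≤ p * (p - 1) := Nat.mul_le_mul_left p (by omega)
      omega
    · omega
  have hp0 : (0 : ℝ) < p := by exact_mod_cast hp
  have hXne := hX.ne_center hp hpn
  obtain ⟨r₀, hr₀, hr₀r, hr₀X⟩ : ∃ r₀ : ℝ, 0 < r₀ ∧ r₀ ≤ r ∧ ∀ i, r₀ ≤ sqDist t (X i) := by
    have : Nonempty (Fin n) := ⟨⟨0, by omega⟩⟩
    obtain ⟨i, hi⟩ := Finite.exists_min fun i => sqDist t (X i)
    exact ⟨min r (sqDist t (X i)),
      lt_min hr (dotProduct_self_pos_of_ne_zero (sub_ne_zero.mpr (hXne i))),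
      min_le_left _ _, fun j => (min_le_right _ _).trans (hi j)⟩
  obtain ⟨M, hpM, hMK⟩ := exists_between hu.K_gt_p
  have hM0 : 0 < M := hp0.trans hpM
  obtain ⟨K', ⟨s₀, hs₀, rfl⟩, hMK', -⟩ := hu.psi_lub.exists_between hMK
  obtain ⟨g, hg, hψ⟩ : ∃ g : ℝ, 0 < g ∧ (1 + g) * M ≤ s₀ * u s₀ := by
    refine ⟨(s₀ * u s₀ - M) / M, div_pos (by linarith) hM0, le_of_eq ?_⟩
    field_simp
    ring
  set e : ℝ := ρ / p
  have he : 0 < e := div_pos hρ hp0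
  set η : ℝ := e * r₀ / s₀ with hη_def
  have hη : 0 < η := by positivity
  set γ : ℝ := min 1 (g * e)
  have hγ : 0 < γ := lt_min one_pos (by positivity)
  have hγ1 : γ ≤ 1 := min_le_left _ _
  have hL : 0 < η * γ ^ p := by positivity
  refine ⟨p * (η * γ ^ p)⁻¹, fun Y h1 h2 V hV => ?_⟩
  have hr₀Z : ∀ j, r₀ ≤ sqDist t (Fin.append X Y j) := by
    intro j
    refine Fin.addCases (fun i => ?_) (fun i => ?_) j
    · rw [Fin.append_left]; exact hr₀X i
    · rw [Fin.append_right]; exact hr₀r.trans (h2 i).le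
  have hne : ∀ j, Fin.append X Y j ≠ t := by
    intro j h
    have := hr₀Z j
    rw [h, sqDist, sub_self, zero_dotProduct] at this
    linarith
  obtain ⟨b, l, hl, hb1, hb, hVb, hinv⟩ := exists_eigenbasis_of_posDef hV.1
  by_cases hall : ∀ i, η * γ ^ p < l i
  · have hdiag : ∀ j, V⁻¹ j j ≤ (η * γ ^ p)⁻¹ := by
      intro j
      have h3 := hinv (Pi.single j 1)
      rw [Matrix.mulVec_single_one, single_one_dotProduct] at h3
      change V⁻¹ j j = _ at h3
      rw [h3]
      calc ∑ i, (b i ⬝ᵥ Pi.single j 1) ^ 2 / l i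
          ≤ ∑ i, (b i ⬝ᵥ Pi.single j 1) ^ 2 / (η * γ ^ p) :=
            Finset.sum_le_sum fun i _ =>
              div_le_div_of_nonneg_left (sq_nonneg _) hL (hall i).le
        _ = (η * γ ^ p)⁻¹ := by
            rw [← Finset.sum_div, hb, single_one_dotProduct, Pi.single_eq_same, one_div]
    calc (V⁻¹).trace ≤ ∑ _j : Fin p, (η * γ ^ p)⁻¹ := Finset.sum_le_sum fun j _ => hdiag j
      _ = p * (η * γ ^ p)⁻¹ := by simp
  exfalso
  push Not at hall
  obtain ⟨i₀, hi₀⟩ := hall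
  obtain ⟨k, hkA, hgap⟩ := exists_gap_s14 hη hγ hγ1 l hi₀
  set A := univ.filter fun i => l i ≤ η * γ ^ (k + 1) with hA_def
  have hcard := h1.card_near_orthogonal_add_card_le hρ (by omega) hne hb ⟨i₀, hkA⟩
  set B := univ.filter fun j => ∑ i ∈ A, (b i ⬝ᵥ (Fin.append X Y j - t)) ^ 2 <
      ρ / p * sqDist t (Fin.append X Y j) with hB_def
  have htr := hV.sum_eigendirections (by omega) hne hl hb1 hVb A
  have hgood : ∀ j ∈ Bᶜ, M ≤ u ((Fin.append X Y j - t) ⬝ᵥ (V⁻¹ *ᵥ (Fin.append X Y j - t))) *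
      ∑ i ∈ A, (b i ⬝ᵥ (Fin.append X Y j - t)) ^ 2 / l i := by
    intro j hj
    rw [hinv]
    have hej : e * sqDist t (Fin.append X Y j) ≤
        ∑ i ∈ A, (b i ⬝ᵥ (Fin.append X Y j - t)) ^ 2 := by
      simpa [hB_def] using hj
    have hτ : η * γ ^ (k + 1) ≤ η :=
      mul_le_of_le_one_right hη.le (pow_le_one₀ hγ.le hγ1)
    refine le_weight_mul_of_gap hu hs₀ hg.le hψ hl (τ := η * γ ^ (k + 1)) (τ' := η * γ ^ k)
      (by positivity) (by positivity) (hb _) (fun i hi => by simpa [hA_def] using hi)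
      (fun i hi => (hgap i (by simpa [hA_def] using hi)).le) hej ?_
      (hr₀.le.trans (hr₀Z j)) rfl ?_
    · have : η * γ ^ (k + 1) = γ * (η * γ ^ k) := by ring
      rw [this]
      exact mul_le_mul_of_nonneg_right (min_le_right _ _) (by positivity)
    · calc s₀ * (η * γ ^ (k + 1)) ≤ s₀ * η := by gcongr
        _ = e * r₀ := by rw [hη_def]; field_simp
        _ ≤ _ := by gcongr; exact hr₀Z j
  have hlow : (#Bᶜ : ℝ) * M ≤ ((n + m : ℕ) : ℝ) * #A := by
    rw [htr, ← nsmul_eq_mul]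
    refine (Finset.card_nsmul_le_sum _ _ _ hgood).trans
      (Finset.sum_le_univ_sum_of_nonneg fun j => mul_nonneg ?_ ?_)
    · refine hu.nonneg ?_
      exact hV.1.inv.dotProduct_mulVec_pos (sub_ne_zero.mpr (hne j))
    · exact Finset.sum_nonneg fun i _ => div_nonneg (sq_nonneg _) (hl i).le
  have hBc : ((#B : ℕ) : ℝ) + #Bᶜ = ((n + m : ℕ) : ℝ) := by
    have := Finset.card_add_card_compl B
    rw [Fintype.card_fin] at this
    exact_mod_cast this
  have hcard' : (#B : ℝ) + #A ≤ p := by exact_mod_cast hcard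
  have hKN : K < ((n + m : ℕ) : ℝ) := by
    have : (1 : ℝ) ≤ m := by exact_mod_cast hm
    push_cast
    linarith
  have hB0 : (0 : ℝ) ≤ #B := Nat.cast_nonneg _
  set N : ℝ := ((n + m : ℕ) : ℝ)
  have hN0 : 0 < N := by linarith
  have e1 : N * #A ≤ N * (p - #B) := by gcongr; linarith
  have e2 : 0 ≤ (#B : ℝ) * (N - M) := mul_nonneg hB0 (by linarith)
  have e3 : 0 < N * (M - p) := mul_pos hN0 (by linarith)
  have e4 : (#Bᶜ : ℝ) = N - #B := by linarith
  rw [e4] at hlow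
  nlinarith
end
end
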